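/- arXiv:1911.00360 — 4 statements merged into one kernel-verified Lean document; each statement's English description precedes it below -/
import Mathlib

section
/- Let f : ℝ³ → ℝ⁵ be a smooth map with f(0) = 0 whose Fréchet derivative at 0 has rank 2 (i.e. f has corank 1 at the origin). Then f is A²-equivalent to at least one of the six normal forms g₁(x,y,z) = (x,y,xz,yz,z²), g₂(x,y,z) = (x,y,z²,xz,0), g₃(x,y,z) = (x,y,xz,yz,0), g₄(x,y,z) = (x,y,z²,0,0), g₅(x,y,z) = (x,y,xz,0,0), g₆(x,y,z) = (x,y,0,0,0). -/
noncomputable section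

/-- Two smooth map germs `(ℝ³,0) → (ℝ⁵,0)` are `𝒜²`-equivalent: there are smooth
changes of coordinates in source and target, fixing the origin and with invertible
differential at the origin, such that the composites have the same 2-jet at `0`. -/
def A2Equiv (f g : (Fin 3 → ℝ) → (Fin 5 → ℝ)) : Prop :=
  ∃ (ψ : (Fin 3 → ℝ) → (Fin 3 → ℝ)) (φ : (Fin 5 → ℝ) → (Fin 5 → ℝ))
    (ψ' : (Fin 3 → ℝ) ≃L[ℝ] (Fin 3 → ℝ)) (φ' : (Fin 5 → ℝ) ≃L[ℝ] (Fin 5 → ℝ)),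
    ContDiff ℝ (⊤ : ℕ∞) ψ ∧ ContDiff ℝ (⊤ : ℕ∞) φ ∧ ψ 0 = 0 ∧ φ 0 = 0 ∧
    HasFDerivAt ψ (ψ' : (Fin 3 → ℝ) →L[ℝ] (Fin 3 → ℝ)) 0 ∧
    HasFDerivAt φ (φ' : (Fin 5 → ℝ) →L[ℝ] (Fin 5 → ℝ)) 0 ∧
    ∀ k : ℕ, k ≤ 2 → iteratedFDeriv ℝ k (φ ∘ f ∘ ψ) 0 = iteratedFDeriv ℝ k g 0

def g1 : (Fin 3 → ℝ) → (Fin 5 → ℝ) := fun p => ![p 0, p 1, p 0 * p 2, p 1 * p 2, p 2 ^ 2]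
def g2 : (Fin 3 → ℝ) → (Fin 5 → ℝ) := fun p => ![p 0, p 1, p 2 ^ 2, p 0 * p 2, 0]
def g3 : (Fin 3 → ℝ) → (Fin 5 → ℝ) := fun p => ![p 0, p 1, p 0 * p 2, p 1 * p 2, 0]
def g4 : (Fin 3 → ℝ) → (Fin 5 → ℝ) := fun p => ![p 0, p 1, p 2 ^ 2, 0, 0]
def g5 : (Fin 3 → ℝ) → (Fin 5 → ℝ) := fun p => ![p 0, p 1, p 0 * p 2, 0, 0]
def g6 : (Fin 3 → ℝ) → (Fin 5 → ℝ) := fun p => ![p 0, p 1, 0, 0, 0]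

section Jets

variable {E F G : Type*} [NormedAddCommGroup E] [NormedSpace ℝ E]
  [NormedAddCommGroup F] [NormedSpace ℝ F] [NormedAddCommGroup G] [NormedSpace ℝ G]

theorem fderiv_fderiv_comp_apply {g : F → G} {f : E → F} (hg : ContDiff ℝ 2 g)
    (hf : ContDiff ℝ 2 f) (x v w : E) :
    fderiv ℝ (fderiv ℝ (g ∘ f)) x v w =
      fderiv ℝ (fderiv ℝ g) (f x) (fderiv ℝ f x v) (fderiv ℝ f x w) +
        fderiv ℝ g (f x) (fderiv ℝ (fderiv ℝ f) x v w) := by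
  have hg1 : Differentiable ℝ g := hg.differentiable two_ne_zero
  have hf1 : Differentiable ℝ f := hf.differentiable two_ne_zero
  have hg2 : Differentiable ℝ (fderiv ℝ g) :=
    (hg.fderiv_right (m := 1) (by norm_num)).differentiable one_ne_zero
  have hf2 : Differentiable ℝ (fderiv ℝ f) :=
    (hf.fderiv_right (m := 1) (by norm_num)).differentiable one_ne_zero
  have h : fderiv ℝ (g ∘ f) = fun y => (fderiv ℝ g (f y)).comp (fderiv ℝ f y) :=
    funext fun y => fderiv_comp y (hg1 _) (hf1 y)
  have hd : HasFDerivAt (fun y => fderiv ℝ g (f y))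
      ((fderiv ℝ (fderiv ℝ g) (f x)).comp (fderiv ℝ f x)) x :=
    (hg2 (f x)).hasFDerivAt.comp x (hf1 x).hasFDerivAt
  rw [h, (hd.clm_comp (hf2 x).hasFDerivAt).fderiv]
  simp [add_comm]

theorem contDiff_linear_add_quadratic (L : E →L[ℝ] F) (B : E →L[ℝ] E →L[ℝ] F) {n : WithTop ℕ∞} :
    ContDiff ℝ n fun x => L x + B x x :=
  L.contDiff.add (B.contDiff.clm_apply contDiff_id)

theorem hasFDerivAt_linear_add_quadratic (L : E →L[ℝ] F) (B : E →L[ℝ] E →L[ℝ] F) (x : E) :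
    HasFDerivAt (fun x => L x + B x x) (L + (B + B.flip) x) x := by
  refine (L.hasFDerivAt.add (B.hasFDerivAt.clm_apply (hasFDerivAt_id x))).congr_fderiv ?_
  ext v
  simp

theorem fderiv_linear_add_quadratic_zero (L : E →L[ℝ] F) (B : E →L[ℝ] E →L[ℝ] F) :
    fderiv ℝ (fun x => L x + B x x) 0 = L := by
  simp [(hasFDerivAt_linear_add_quadratic L B 0).fderiv]

theorem fderiv_fderiv_linear_add_quadratic (L : E →L[ℝ] F) (B : E →L[ℝ] E →L[ℝ] F) (x : E) :
    fderiv ℝ (fderiv ℝ fun x => L x + B x x) x = B + B.flip := by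
  have h : fderiv ℝ (fun x => L x + B x x) = fun x => L + (B + B.flip) x :=
    funext fun x => (hasFDerivAt_linear_add_quadratic L B x).fderiv
  rw [h, ((B + B.flip).hasFDerivAt.const_add L).fderiv]

theorem ContinuousLinearMap.eq_of_symm_of_apply_self_eq {B C : E →L[ℝ] E →L[ℝ] F}
    (hB : ∀ v w, B v w = B w v) (hC : ∀ v w, C v w = C w v) (h : ∀ v, B v v = C v v) : B = C := by
  ext v w
  have h1 := h (v + w)
  simp only [map_add, add_apply, h v, h w, hB w v, hC w v] at h1
  have h2 : (2 : ℝ) • B v w = (2 : ℝ) • C v w := by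
    rw [two_smul, two_smul]
    apply add_left_cancel (a := C v v)
    apply add_right_cancel (b := C w w)
    convert h1 using 1 <;> abel
  exact smul_right_injective F (two_ne_zero' ℝ) h2

theorem iteratedFDeriv_eq_of_le_two {f g : E → F} (x : E) (h0 : f x = g x)
    (h1 : fderiv ℝ f x = fderiv ℝ g x)
    (h2 : fderiv ℝ (fderiv ℝ f) x = fderiv ℝ (fderiv ℝ g) x) {k : ℕ} (hk : k ≤ 2) :
    iteratedFDeriv ℝ k f x = iteratedFDeriv ℝ k g x := by
  interval_cases k
  · ext m; simp [h0]
  · ext m; simp [iteratedFDeriv_one_apply, h1]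
  · ext m; simp [iteratedFDeriv_two_apply, h2]

end Jets

section JetAlgebra

variable {E F E' F' E'' F'' : Type*} [AddCommGroup E] [Module ℝ E] [AddCommGroup F] [Module ℝ F]
  [AddCommGroup E'] [Module ℝ E'] [AddCommGroup F'] [Module ℝ F']
  [AddCommGroup E''] [Module ℝ E''] [AddCommGroup F''] [Module ℝ F'']

/-- Equivalence of the 2-jets `L + q` and `L' + q'` (with `L`, `L'` linear and `q`, `q'` quadratic)
under the 2-jets `S + a` and `P + b` of coordinate changes in source and target. -/
def Jet2Rel (L : E →ₗ[ℝ] F) (q : E → F) (L' : E' →ₗ[ℝ] F') (q' : E' → F') : Prop :=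
  ∃ (S : E' ≃ₗ[ℝ] E) (P : F ≃ₗ[ℝ] F') (a : E' →ₗ[ℝ] E' →ₗ[ℝ] E) (b : F →ₗ[ℝ] F →ₗ[ℝ] F'),
    (∀ v, P (L (S v)) = L' v) ∧
      ∀ v, b (L (S v)) (L (S v)) + P (q (S v) + L (a v v)) = q' v

theorem Jet2Rel.trans {L : E →ₗ[ℝ] F} {q : E → F} {L' : E' →ₗ[ℝ] F'} {q' : E' → F'}
    {L'' : E'' →ₗ[ℝ] F''} {q'' : E'' → F''} (h : Jet2Rel L q L' q') (h' : Jet2Rel L' q' L'' q'') :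
    Jet2Rel L q L'' q'' := by
  obtain ⟨S, P, a, b, h1, h2⟩ := h
  obtain ⟨S', P', a', b', h1', h2'⟩ := h'
  refine ⟨S' ≪≫ₗ S, P ≪≫ₗ P', a.compl₁₂ S'.toLinearMap S'.toLinearMap + a'.compr₂ S.toLinearMap,
    b'.compl₁₂ P.toLinearMap P.toLinearMap + b.compr₂ P'.toLinearMap, fun v => ?_, fun v => ?_⟩
  · simp [h1, h1']
  · rw [← h2', ← h2, ← h1, ← h1]
    simp only [LinearEquiv.trans_apply, LinearMap.add_apply, LinearMap.compl₁₂_apply,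
      LinearMap.compr₂_apply, LinearEquiv.coe_coe, map_add]
    abel

theorem Jet2Rel.of_linearEquiv {L : E →ₗ[ℝ] F} {q : E → F} {L' : E' →ₗ[ℝ] F'} {q' : E' → F'}
    (S : E' ≃ₗ[ℝ] E) (P : F ≃ₗ[ℝ] F') (h1 : ∀ v, P (L (S v)) = L' v)
    (h2 : ∀ v, P (q (S v)) = q' v) : Jet2Rel L q L' q' :=
  ⟨S, P, 0, 0, h1, by simpa using h2⟩

/-- The linear part `(x, z) ↦ (x, 0)` of a corank one jet in adapted coordinates. -/
def fstZero (X Y : Type*) [AddCommGroup X] [Module ℝ X] [AddCommGroup Y] [Module ℝ Y] :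
    X × ℝ →ₗ[ℝ] X × Y :=
  LinearMap.inl ℝ X Y ∘ₗ LinearMap.fst ℝ X ℝ

/-- The quadratic map `(x, z) ↦ (0, z β(x) + z² c)`. -/
def pencilQuad (β : E →ₗ[ℝ] F) (c : F) (v : E × ℝ) : E × F :=
  (0, v.2 • β v.1 + v.2 ^ 2 • c)

theorem exists_linearEquiv_fstZero {m n : ℕ} [FiniteDimensional ℝ E] [FiniteDimensional ℝ F]
    (T : E →ₗ[ℝ] F) (hT : Module.finrank ℝ (LinearMap.range T) = m)
    (hE : Module.finrank ℝ E = m + 1) (hF : Module.finrank ℝ F = m + n) :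
    ∃ (S : ((Fin m → ℝ) × ℝ) ≃ₗ[ℝ] E) (P : F ≃ₗ[ℝ] (Fin m → ℝ) × (Fin n → ℝ)),
      ∀ v, P (T (S v)) = fstZero (Fin m → ℝ) (Fin n → ℝ) v := by
  obtain ⟨K, hK⟩ := T.ker.exists_isCompl
  obtain ⟨W, hW⟩ := T.range.exists_isCompl
  have hker := T.finrank_range_add_finrank_ker
  have hWd := Submodule.finrank_add_eq_of_isCompl hW
  let eX : T.range ≃ₗ[ℝ] (Fin m → ℝ) := LinearEquiv.ofFinrankEq _ _ (by simp [hT])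
  let eK : T.ker ≃ₗ[ℝ] ℝ := LinearEquiv.ofFinrankEq _ _ (by simp; omega)
  let eW : W ≃ₗ[ℝ] (Fin n → ℝ) := LinearEquiv.ofFinrankEq _ _ (by simp; omega)
  let e : E ≃ₗ[ℝ] T.range × T.ker :=
    LinearMap.equivProdOfSurjectiveOfIsCompl T.rangeRestrict (T.ker.projectionOnto K hK)
      T.range_rangeRestrict (by simp) (by simpa using hK)
  refine ⟨(e ≪≫ₗ eX.prodCongr eK).symm,
    (T.range.prodEquivOfIsCompl W hW).symm ≪≫ₗ eX.prodCongr eW, fun v => ?_⟩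
  obtain ⟨u, rfl⟩ := (e ≪≫ₗ eX.prodCongr eK).surjective v
  have hu : (T.range.prodEquivOfIsCompl W hW).symm (T u) = (T.rangeRestrict u, 0) :=
    Submodule.prodEquivOfIsCompl_symm_apply_left _ _ hW (T.rangeRestrict u)
  rw [LinearEquiv.symm_apply_apply, LinearEquiv.trans_apply, hu]
  simp [e, fstZero]

theorem jet2Rel_pencilQuad (C : E × ℝ →ₗ[ℝ] E × ℝ →ₗ[ℝ] E × F) :
    ∃ β c, Jet2Rel (fstZero E F) (fun v => C v v) (fstZero E F) (pencilQuad β c) := by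
  let iE := LinearMap.inl ℝ E ℝ
  let s := LinearMap.snd ℝ E F
  refine ⟨s ∘ₗ (C.flip (0, 1) + C (0, 1)) ∘ₗ iE, (C (0, 1) (0, 1)).2,
    LinearEquiv.refl ℝ _, LinearEquiv.refl ℝ _, -C.compr₂ (iE ∘ₗ LinearMap.fst ℝ E F),
    -(C.compl₁₂ (iE ∘ₗ LinearMap.fst ℝ E F) (iE ∘ₗ LinearMap.fst ℝ E F)).compr₂
      (LinearMap.inr ℝ E F ∘ₗ s), fun v => rfl, fun ⟨x, z⟩ => ?_⟩
  have hv : ((x, z) : E × ℝ) = (x, 0) + z • (0, 1) := by simp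
  have hC : C (x, z) (x, z) = C (x, 0) (x, 0) + z • (C (x, 0) (0, 1) + C (0, 1) (x, 0)) +
      z ^ 2 • C (0, 1) (0, 1) := by
    rw [hv]
    simp only [map_add, map_smul, LinearMap.add_apply, LinearMap.smul_apply]
    module
  ext1
  · simp [pencilQuad, fstZero, iE, s]
  · simp [pencilQuad, fstZero, iE, s, hC]
    abel

theorem jet2Rel_pencilQuad_pencilQuad {β β' : E →ₗ[ℝ] F} {c c' : F} (U : E ≃ₗ[ℝ] E)
    (V : F ≃ₗ[ℝ] F) (l : E →ₗ[ℝ] ℝ) (hc : V c = c')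
    (hβ : ∀ x, V (β (U x)) + l x • c' = β' x) :
    Jet2Rel (fstZero E F) (pencilQuad β c) (fstZero E F) (pencilQuad β' c') := by
  let m : E →ₗ[ℝ] ℝ := (1 / 2 : ℝ) • l
  let b : E × F →ₗ[ℝ] E × F →ₗ[ℝ] E × F := LinearMap.mk₂ ℝ
    (fun y y' => (0, m (U.symm y.1) • (V (β y'.1) + m (U.symm y'.1) • c')))
    (fun y₁ y₂ y => by ext1 <;> simp [add_smul]; abel)
    (fun r y₁ y₂ => by ext1 <;> simp [mul_smul])
    (fun y y₁ y₂ => by ext1 <;> simp [smul_add, add_smul]; abel)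
    (fun r y₁ y₂ => by ext1 <;> simp [mul_smul, smul_add, smul_comm r])
  refine ⟨U.skewProd (LinearEquiv.refl ℝ ℝ) m, U.symm.prodCongr V, 0, -b, fun v => ?_,
    fun ⟨x, z⟩ => ?_⟩
  · ext1 <;> simp [fstZero]
  · ext1
    · simp [fstZero, b, pencilQuad]
    · simp only [fstZero, b, pencilQuad, ← hβ, hc, LinearMap.neg_apply, LinearMap.mk₂_apply,
        LinearMap.comp_apply, LinearMap.inl_apply, LinearMap.fst_apply, LinearEquiv.skewProd_apply,
        LinearMap.zero_apply, map_zero, add_zero, LinearEquiv.prodCongr_apply, Prod.snd_add,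
        Prod.snd_neg, LinearEquiv.symm_apply_apply, map_add, map_smul, LinearEquiv.refl_apply]
      simp only [m, LinearMap.smul_apply, smul_eq_mul]
      module

theorem LinearIndependent.exists_linearEquiv_apply_eq {ι : Type*} [Finite ι] {v w : ι → E}
    (hv : LinearIndependent ℝ v) (hw : LinearIndependent ℝ w) :
    ∃ V : E ≃ₗ[ℝ] E, ∀ i, V (v i) = w i := by
  have := FiniteDimensional.span_of_finite ℝ (Set.finite_range v)
  obtain ⟨V, hV⟩ := Submodule.exists_linearEquiv_restrict_eq
    (hv.linearCombinationEquiv.symm ≪≫ₗ hw.linearCombinationEquiv)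
  refine ⟨V, fun i => ?_⟩
  have h := hV (hv.linearCombinationEquiv (Finsupp.single i 1))
  simpa using h.symm

end JetAlgebra

section Classification

theorem A2Equiv.of_jet2Rel {f g : (Fin 3 → ℝ) → (Fin 5 → ℝ)} (hf : ContDiff ℝ (⊤ : ℕ∞) f)
    (h0 : f 0 = 0) {L : (Fin 3 → ℝ) →ₗ[ℝ] (Fin 5 → ℝ)}
    {B : (Fin 3 → ℝ) →ₗ[ℝ] (Fin 3 → ℝ) →ₗ[ℝ] (Fin 5 → ℝ)} (hg : ∀ v, g v = L v + B v v)
    (h : Jet2Rel (fderiv ℝ f 0).toLinearMap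
      (fun v => (1 / 2 : ℝ) • fderiv ℝ (fderiv ℝ f) 0 v v) L (fun v => B v v)) :
    A2Equiv f g := by
  obtain ⟨S, P, a, b, h1, h2⟩ := h
  simp only [ContinuousLinearMap.coe_coe] at h1 h2
  let S' := S.toContinuousLinearEquiv
  let P' := P.toContinuousLinearEquiv
  let a' := a.toContinuousBilinearMap
  let b' := b.toContinuousBilinearMap
  let L' := L.toContinuousLinearMap
  let B' := B.toContinuousBilinearMap
  let ψ := fun x => (S' : (Fin 3 → ℝ) →L[ℝ] (Fin 3 → ℝ)) x + a' x x
  let φ := fun x => (P' : (Fin 5 → ℝ) →L[ℝ] (Fin 5 → ℝ)) x + b' x x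
  have hψ0 : ψ 0 = 0 := by simp [ψ]
  have hφ0 : φ 0 = 0 := by simp [φ]
  have hψ {n} : ContDiff ℝ n ψ := contDiff_linear_add_quadratic _ _
  have hφ {n} : ContDiff ℝ n φ := contDiff_linear_add_quadratic _ _
  have hψ1 : fderiv ℝ ψ 0 = S' := fderiv_linear_add_quadratic_zero _ _
  have hφ1 : fderiv ℝ φ 0 = P' := fderiv_linear_add_quadratic_zero _ _
  have hψ2 : fderiv ℝ (fderiv ℝ ψ) 0 = a' + a'.flip := fderiv_fderiv_linear_add_quadratic _ _ _
  have hφ2 : fderiv ℝ (fderiv ℝ φ) 0 = b' + b'.flip := fderiv_fderiv_linear_add_quadratic _ _ _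
  have hf2 : ContDiff ℝ 2 f := hf.of_le (WithTop.coe_le_coe.2 le_top)
  have hg' : g = fun x => L' x + B' x x := funext hg
  have hg1 : fderiv ℝ g 0 = L' := hg' ▸ fderiv_linear_add_quadratic_zero _ _
  have hg2 : fderiv ℝ (fderiv ℝ g) 0 = B' + B'.flip :=
    hg' ▸ fderiv_fderiv_linear_add_quadratic _ _ _
  have hfψ : ContDiff ℝ 2 (f ∘ ψ) := hf2.comp hψ
  have hφfψ : ContDiff ℝ 2 (φ ∘ f ∘ ψ) := hφ.comp hfψ
  have hfψ1 : fderiv ℝ (f ∘ ψ) 0 = (fderiv ℝ f 0).comp (S' : (Fin 3 → ℝ) →L[ℝ] (Fin 3 → ℝ)) := by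
    rw [fderiv_comp _ (hf2.differentiable two_ne_zero _) (hψ.differentiable one_ne_zero _),
      hψ0, hψ1]
  refine ⟨ψ, φ, S', P', hψ, hφ, hψ0, hφ0, hψ1 ▸ (hψ.differentiable one_ne_zero 0).hasFDerivAt,
    hφ1 ▸ (hφ.differentiable one_ne_zero 0).hasFDerivAt,
    fun k hk => iteratedFDeriv_eq_of_le_two 0 ?_ ?_ ?_ hk⟩
  · simp [hψ0, h0, hφ0, hg]
  · rw [fderiv_comp _ (hφ.differentiable one_ne_zero _) (hfψ.differentiable two_ne_zero _), hfψ1,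
      hg1, Function.comp_apply, hψ0, h0, hφ1]
    ext1 v
    exact h1 v
  · refine ContinuousLinearMap.eq_of_symm_of_apply_self_eq
      (hφfψ.contDiffAt.isSymmSndFDerivAt (by simp)).eq ?_ fun v => ?_
    · simp [hg2, add_comm]
    · rw [fderiv_fderiv_comp_apply hφ hfψ, fderiv_fderiv_comp_apply hf2 hψ, hfψ1,
        Function.comp_apply, hψ0, h0, hψ1, hφ1, hψ2, hφ2, hg2]
      change b (fderiv ℝ f 0 (S v)) (fderiv ℝ f 0 (S v)) +
        b (fderiv ℝ f 0 (S v)) (fderiv ℝ f 0 (S v)) +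
        P (fderiv ℝ (fderiv ℝ f) 0 (S v) (S v) + fderiv ℝ f 0 (a v v + a v v)) = B v v + B v v
      rw [← h2 v]
      simp only [map_add, map_smul]
      module

/-- The linear map `x ↦ x₀ u + x₁ w`. -/
def pencil (u w : Fin 3 → ℝ) : (Fin 2 → ℝ) →ₗ[ℝ] (Fin 3 → ℝ) :=
  Fintype.linearCombination ℝ ![u, w]

theorem pencil_apply (u w : Fin 3 → ℝ) (x : Fin 2 → ℝ) : pencil u w x = x 0 • u + x 1 • w := by
  simp [pencil, Fintype.linearCombination_apply]

/-- The germ `(x, y, z) ↦ (x, y, x z u + y z w + z² c)`. -/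
def pencilGerm (u w c : Fin 3 → ℝ) (p : Fin 3 → ℝ) : Fin 5 → ℝ :=
  Fin.append ![p 0, p 1] (p 2 • pencil u w ![p 0, p 1] + p 2 ^ 2 • c)

theorem A2Equiv.pencilGerm_of_jet2Rel {f : (Fin 3 → ℝ) → (Fin 5 → ℝ)}
    (hf : ContDiff ℝ (⊤ : ℕ∞) f) (h0 : f 0 = 0) {u w c : Fin 3 → ℝ}
    (h : Jet2Rel (fderiv ℝ f 0).toLinearMap (fun v => (1 / 2 : ℝ) • fderiv ℝ (fderiv ℝ f) 0 v v)
      (fstZero (Fin 2 → ℝ) (Fin 3 → ℝ)) (pencilQuad (pencil u w) c)) :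
    A2Equiv f (pencilGerm u w c) := by
  let S : (Fin 3 → ℝ) ≃ₗ[ℝ] (Fin 2 → ℝ) × ℝ :=
    { toFun := fun p => (![p 0, p 1], p 2)
      invFun := fun v => ![v.1 0, v.1 1, v.2]
      map_add' := fun p q => by ext i <;> [fin_cases i; skip] <;> simp
      map_smul' := fun r p => by ext i <;> [fin_cases i; skip] <;> simp
      left_inv := fun p => by ext i; fin_cases i <;> rfl
      right_inv := fun v => by ext i <;> [fin_cases i; skip] <;> rfl }
  let P : ((Fin 2 → ℝ) × (Fin 3 → ℝ)) ≃ₗ[ℝ] (Fin 5 → ℝ) :=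
    { Fin.appendEquiv 2 3 with
      map_add' := fun p q => by
        ext i; refine Fin.addCases (fun i => ?_) (fun i => ?_) i <;> simp [Fin.appendEquiv]
      map_smul' := fun r p => by
        ext i; refine Fin.addCases (fun i => ?_) (fun i => ?_) i <;> simp [Fin.appendEquiv] }
  let B : (Fin 3 → ℝ) →ₗ[ℝ] (Fin 3 → ℝ) →ₗ[ℝ] (Fin 2 → ℝ) × (Fin 3 → ℝ) := LinearMap.mk₂ ℝ
    (fun p q => (0, p 2 • (pencil u w (S q).1 + q 2 • c)))
    (fun p q y => by ext1 <;> simp [add_smul]; abel)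
    (fun r p q => by ext1 <;> simp [mul_smul])
    (fun p q y => by ext1 <;> simp [smul_add, add_smul]; abel)
    (fun r p q => by ext1 <;> simp [mul_smul, smul_add, smul_comm r])
  have hB (v) : B v v = pencilQuad (pencil u w) c (S v) := by
    ext1
    · rfl
    · simp [B, pencilQuad, S, smul_smul, sq]
  refine A2Equiv.of_jet2Rel hf h0 (L := P.toLinearMap ∘ₗ fstZero _ _ ∘ₗ S.toLinearMap)
    (B := B.compr₂ P.toLinearMap) (fun v => ?_)
    (h.trans (Jet2Rel.of_linearEquiv S P (fun v => rfl) fun v => ?_))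
  · simp only [LinearMap.comp_apply, LinearMap.compr₂_apply, LinearEquiv.coe_coe, ← map_add, hB]
    simp [fstZero, pencilQuad, S, P, pencilGerm, Fin.appendEquiv]
  · simp [hB]

theorem exists_forall_eq_pencil {β : (Fin 2 → ℝ) →ₗ[ℝ] (Fin 3 → ℝ)} {u w c c' : Fin 3 → ℝ}
    (U : (Fin 2 → ℝ) ≃ₗ[ℝ] (Fin 2 → ℝ)) (V : (Fin 3 → ℝ) ≃ₗ[ℝ] (Fin 3 → ℝ)) (s t : ℝ)
    (hc : V c = c') (hu : V (β (U (Pi.single 0 1))) + s • c' = u)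
    (hw : V (β (U (Pi.single 1 1))) + t • c' = w) :
    ∃ (U : (Fin 2 → ℝ) ≃ₗ[ℝ] (Fin 2 → ℝ)) (V : (Fin 3 → ℝ) ≃ₗ[ℝ] (Fin 3 → ℝ))
      (l : (Fin 2 → ℝ) →ₗ[ℝ] ℝ), V c = c' ∧ ∀ x, V (β (U x)) + l x • c' = pencil u w x := by
  refine ⟨U, V, Fintype.linearCombination ℝ ![s, t], hc, fun x => ?_⟩
  have hx : x = x 0 • Pi.single 0 1 + x 1 • Pi.single 1 1 := by
    ext i; fin_cases i <;> simp
  have hl : Fintype.linearCombination ℝ ![s, t] x = x 0 * s + x 1 * t := by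
    simp [Fintype.linearCombination_apply]
  rw [hl, pencil_apply, ← hu, ← hw]
  have hU := congrArg U hx
  simp only [map_add, map_smul] at hU
  rw [hU]
  simp only [map_add, map_smul]
  module

theorem linearIndependent_single_comp {n : ℕ} {v : Fin n → Fin 3} (hv : Function.Injective v) :
    LinearIndependent ℝ fun i => (Pi.single (v i) 1 : Fin 3 → ℝ) := by
  have h := (Pi.basisFun ℝ (Fin 3)).linearIndependent.comp v hv
  convert h using 2 with i
  simp

theorem exists_linearEquiv_map_single {n : ℕ} {y : Fin n → Fin 3 → ℝ} (hy : LinearIndependent ℝ y)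
    {v : Fin n → Fin 3} (hv : Function.Injective v) :
    ∃ V : (Fin 3 → ℝ) ≃ₗ[ℝ] (Fin 3 → ℝ), ∀ i, V (y i) = Pi.single (v i) 1 :=
  hy.exists_linearEquiv_apply_eq (linearIndependent_single_comp hv)

theorem exists_linearEquiv_pencil (β : (Fin 2 → ℝ) →ₗ[ℝ] (Fin 3 → ℝ)) (c : Fin 3 → ℝ) :
    ∃ u w c', (∃ (U : (Fin 2 → ℝ) ≃ₗ[ℝ] (Fin 2 → ℝ)) (V : (Fin 3 → ℝ) ≃ₗ[ℝ] (Fin 3 → ℝ))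
      (l : (Fin 2 → ℝ) →ₗ[ℝ] ℝ), V c = c' ∧ ∀ x, V (β (U x)) + l x • c' = pencil u w x) ∧
    ((u, w, c') = (Pi.single 0 1, Pi.single 1 1, Pi.single 2 1) ∨
      (u, w, c') = (Pi.single 1 1, 0, Pi.single 0 1) ∨
      (u, w, c') = (Pi.single 0 1, Pi.single 1 1, 0) ∨
      (u, w, c') = (0, 0, Pi.single 0 1) ∨
      (u, w, c') = (Pi.single 0 1, 0, 0) ∨
      (u, w, c') = (0, 0, 0)) := by
  by_cases hβ : ∃ x, x ≠ 0 ∧ ∃ r : ℝ, β x = r • c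
  · obtain ⟨x, hx, r, hr⟩ := hβ
    obtain ⟨U, hU⟩ := LinearIndependent.exists_linearEquiv_apply_eq (ι := Unit)
      (v := fun _ => (Pi.single 1 1 : Fin 2 → ℝ)) (w := fun _ => x)
      (.of_subsingleton () (by simp)) (.of_subsingleton () hx)
    replace hU := hU ()
    by_cases hx' : ∃ r' : ℝ, β (U (Pi.single 0 1)) = r' • c
    · obtain ⟨r', hr'⟩ := hx'
      by_cases hc : c = 0
      · exact ⟨0, 0, 0,
          exists_forall_eq_pencil U (.refl ℝ _) 0 0 hc (by simp [hr', hc]) (by simp [hU, hr, hc]),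
          by tauto⟩
      · obtain ⟨V, hV⟩ := exists_linearEquiv_map_single (n := 1) (y := ![c]) (v := ![0])
          (.of_subsingleton 0 hc) (Function.injective_of_subsingleton _)
        have hVc : V c = Pi.single 0 1 := hV 0
        exact ⟨0, 0, Pi.single 0 1,
          exists_forall_eq_pencil U V (-r') (-r) hVc (by simp [hr', hVc]) (by simp [hU, hr, hVc]),
          by tauto⟩
    · push Not at hx'
      by_cases hc : c = 0
      · obtain ⟨V, hV⟩ := exists_linearEquiv_map_single (n := 1) (y := ![β (U (Pi.single 0 1))])
          (v := ![0]) (.of_subsingleton 0 (by simpa using hx' 0))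
          (Function.injective_of_subsingleton _)
        exact ⟨Pi.single 0 1, 0, 0,
          exists_forall_eq_pencil U V 0 0 (by simp [hc]) (by simpa using hV 0) (by simp [hU, hr, hc]),
          by tauto⟩
      · obtain ⟨V, hV⟩ := exists_linearEquiv_map_single (n := 2)
          (y := ![c, β (U (Pi.single 0 1))]) (v := ![0, 1])
          ((LinearIndependent.pair_iff' hc).2 fun a h => hx' a h.symm) (by decide)
        have hVc : V c = Pi.single 0 1 := hV 0
        have hVu : V (β (U (Pi.single 0 1))) = Pi.single 1 1 := hV 1
        exact ⟨Pi.single 1 1, 0, Pi.single 0 1,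
          exists_forall_eq_pencil U V 0 (-r) hVc (by simpa using hVu) (by simp [hU, hr, hVc]),
          by tauto⟩
  · push Not at hβ
    have hind : ∀ a b r : ℝ, a • β (Pi.single 0 1) + b • β (Pi.single 1 1) = r • c →
        a = 0 ∧ b = 0 := by
      intro a b r h
      have h0 : a • Pi.single 0 1 + b • Pi.single 1 1 = (0 : Fin 2 → ℝ) := by
        by_contra hne
        exact hβ _ hne r (by simpa using h)
      exact ⟨by simpa using congrFun h0 0, by simpa using congrFun h0 1⟩
    by_cases hc : c = 0
    · obtain ⟨V, hV⟩ := exists_linearEquiv_map_single (n := 2)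
        (y := ![β (Pi.single 0 1), β (Pi.single 1 1)]) (v := ![0, 1])
        (LinearIndependent.pair_iff.2 fun a b h => hind a b 0 (by simpa using h)) (by decide)
      exact ⟨Pi.single 0 1, Pi.single 1 1, 0,
          exists_forall_eq_pencil (.refl ℝ _) V 0 0 (by simp [hc]) (by simpa using hV 0)
        (by simpa using hV 1), by tauto⟩
    · obtain ⟨V, hV⟩ := exists_linearEquiv_map_single (n := 3)
        (y := ![β (Pi.single 0 1), β (Pi.single 1 1), c]) (v := ![0, 1, 2])
        (Fintype.linearIndependent_iff.2 fun a h => by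
          simp only [Fin.sum_univ_three, Matrix.cons_val] at h
          obtain ⟨h0, h1⟩ := hind (a 0) (a 1) (-a 2)
            (by rw [neg_smul]; exact eq_neg_of_add_eq_zero_left h)
          have h2 : a 2 = 0 := by simpa [h0, h1, hc] using h
          intro i; fin_cases i <;> assumption) (by decide)
      exact ⟨Pi.single 0 1, Pi.single 1 1, Pi.single 2 1,
          exists_forall_eq_pencil (.refl ℝ _) V 0 0 (hV 2) (by simpa using hV 0)
        (by simpa using hV 1), by tauto⟩

end Classification

/-- Any smooth corank 1 map germ `(ℝ³,0) → (ℝ⁵,0)` (i.e. with differential of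
rank 2 at the origin) is `𝒜²`-equivalent to one of the six normal forms. -/
theorem corank_one_A2_classification (f : (Fin 3 → ℝ) → (Fin 5 → ℝ))
    (hf : ContDiff ℝ (⊤ : ℕ∞) f) (h0 : f 0 = 0)
    (hrank : Module.finrank ℝ (LinearMap.range (fderiv ℝ f 0).toLinearMap) = 2) :
    A2Equiv f g1 ∨ A2Equiv f g2 ∨ A2Equiv f g3 ∨ A2Equiv f g4 ∨
      A2Equiv f g5 ∨ A2Equiv f g6 := by
  obtain ⟨S, P, hSP⟩ := exists_linearEquiv_fstZero (n := 3) _ hrank (by simp) (by simp)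
  let D := (1 / 2 : ℝ) • fderiv ℝ (fderiv ℝ f) 0
  obtain ⟨β, c, hC⟩ := jet2Rel_pencilQuad
    ((LinearMap.mk₂ ℝ (fun v w => D v w) (by simp) (by simp) (by simp) (by simp)).compl₁₂
      S.toLinearMap S.toLinearMap |>.compr₂ P.toLinearMap)
  obtain ⟨u, w, c', ⟨U, V, l, hc, hβ⟩, hcases⟩ := exists_linearEquiv_pencil β c
  have key : A2Equiv f (pencilGerm u w c') :=
    A2Equiv.pencilGerm_of_jet2Rel hf h0 <|
      (Jet2Rel.of_linearEquiv S P hSP fun v => rfl).trans <| hC.trans <|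
        jet2Rel_pencilQuad_pencilQuad U V l hc hβ
  have e1 : pencilGerm (Pi.single 0 1) (Pi.single 1 1) (Pi.single 2 1) = g1 := by
    ext p i; fin_cases i <;> simp [pencilGerm, pencil_apply, g1, Fin.append, Fin.addCases, mul_comm]
  have e2 : pencilGerm (Pi.single 1 1) 0 (Pi.single 0 1) = g2 := by
    ext p i; fin_cases i <;> simp [pencilGerm, pencil_apply, g2, Fin.append, Fin.addCases, mul_comm]
  have e3 : pencilGerm (Pi.single 0 1) (Pi.single 1 1) 0 = g3 := by
    ext p i; fin_cases i <;> simp [pencilGerm, pencil_apply, g3, Fin.append, Fin.addCases, mul_comm]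
  have e4 : pencilGerm 0 0 (Pi.single 0 1) = g4 := by
    ext p i; fin_cases i <;> simp [pencilGerm, pencil_apply, g4, Fin.append, Fin.addCases]
  have e5 : pencilGerm (Pi.single 0 1) 0 0 = g5 := by
    ext p i; fin_cases i <;> simp [pencilGerm, pencil_apply, g5, Fin.append, Fin.addCases, mul_comm]
  have e6 : pencilGerm 0 0 0 = g6 := by
    ext p i; fin_cases i <;> simp [pencilGerm, pencil_apply, g6, Fin.append, Fin.addCases]
  simp only [Prod.mk.injEq] at hcases
  rcases hcases with ⟨rfl, rfl, rfl⟩ | ⟨rfl, rfl, rfl⟩ | ⟨rfl, rfl, rfl⟩ | ⟨rfl, rfl, rfl⟩ |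
    ⟨rfl, rfl, rfl⟩ | ⟨rfl, rfl, rfl⟩ <;>
    simp only [e1, e2, e3, e4, e5, e6] at key <;> tauto
end
end

section
/- No two distinct maps among the six normal forms g₁(x,y,z) = (x,y,xz,yz,z²), g₂(x,y,z) = (x,y,z²,xz,0), g₃(x,y,z) = (x,y,xz,yz,0), g₄(x,y,z) = (x,y,z²,0,0), g₅(x,y,z) = (x,y,xz,0,0), g₆(x,y,z) = (x,y,0,0,0) are A²-equivalent; that is, for i ≠ j, gᵢ and gⱼ are not A²-equivalent. -/
noncomputable section

/-- The six normal forms, indexed. -/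
def normalForm : Fin 6 → (Fin 3 → ℝ) → (Fin 5 → ℝ) := ![g1, g2, g3, g4, g5, g6]

/-- The second derivative of `φ ∘ f ∘ ψ` at a point, with second argument in the kernel of the
first derivative of `f ∘ ψ`, does not involve the second derivative of `φ`. -/
theorem fderiv_fderiv_comp_comp_apply_of_eq_zero
    {E E' F F' : Type*} [NormedAddCommGroup E] [NormedSpace ℝ E]
    [NormedAddCommGroup E'] [NormedSpace ℝ E'] [NormedAddCommGroup F] [NormedSpace ℝ F]
    [NormedAddCommGroup F'] [NormedSpace ℝ F']
    {φ : F → F'} {f : E' → F} {ψ : E → E'}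
    (hφ : ContDiff ℝ 2 φ) (hf : ContDiff ℝ 2 f) (hψ : ContDiff ℝ 2 ψ)
    (x v k : E) (hk : fderiv ℝ f (ψ x) (fderiv ℝ ψ x k) = 0) :
    fderiv ℝ (fderiv ℝ (φ ∘ f ∘ ψ)) x v k =
      fderiv ℝ φ (f (ψ x))
        (fderiv ℝ (fderiv ℝ f) (ψ x) (fderiv ℝ ψ x v) (fderiv ℝ ψ x k) +
          fderiv ℝ f (ψ x) (fderiv ℝ (fderiv ℝ ψ) x v k)) := by
  have dφ := hφ.differentiable (by norm_num)
  have df := hf.differentiable (by norm_num)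
  have dψ := hψ.differentiable (by norm_num)
  have ddφ : Differentiable ℝ (fderiv ℝ φ) :=
    (hφ.fderiv_right (m := 1) (by norm_num)).differentiable (by norm_num)
  have ddf : Differentiable ℝ (fderiv ℝ f) :=
    (hf.fderiv_right (m := 1) (by norm_num)).differentiable (by norm_num)
  have ddψ : Differentiable ℝ (fderiv ℝ ψ) :=
    (hψ.fderiv_right (m := 1) (by norm_num)).differentiable (by norm_num)
  have hfirst : fderiv ℝ (φ ∘ f ∘ ψ) = fun y =>
      (fderiv ℝ φ (f (ψ y))).comp ((fderiv ℝ f (ψ y)).comp (fderiv ℝ ψ y)) := by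
    funext y
    rw [fderiv_comp y (dφ _) ((df.comp dψ) y), fderiv_comp y (df _) (dψ y)]
    rfl
  have hψx := (dψ x).hasFDerivAt
  have h1 := (ddf (ψ x)).hasFDerivAt.comp x hψx
  have h2 := h1.clm_comp (ddψ x).hasFDerivAt
  have h3 := (ddφ (f (ψ x))).hasFDerivAt.comp x ((df (ψ x)).hasFDerivAt.comp x hψx)
  rw [hfirst]
  have h4 := (h3.clm_comp h2).fderiv
  simp only [Function.comp_def] at h4
  rw [h4]
  simp [hk, add_comm]

/-- The common linear part `(x, y, z) ↦ (x, y, 0, 0, 0)` of the normal forms. -/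
def linearPart : (Fin 3 → ℝ) →L[ℝ] (Fin 5 → ℝ) :=
  LinearMap.toContinuousLinearMap
    (Matrix.toLin' !![1, 0, 0; 0, 1, 0; 0, 0, 0; 0, 0, 0; 0, 0, 0])

/-- The maps with linear part `linearPart` and quadratic part `p ↦ z • M p`. -/
def germ (M : (Fin 3 → ℝ) →L[ℝ] (Fin 5 → ℝ)) : (Fin 3 → ℝ) → (Fin 5 → ℝ) :=
  fun p => linearPart p + p 2 • M p

/-- The kernel direction of `linearPart`. -/
def kerVec : Fin 3 → ℝ := ![0, 0, 1]

/-- The second derivative of `germ M` at `0`, contracted with `kerVec`. -/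
def intrinsic (M : (Fin 3 → ℝ) →L[ℝ] (Fin 5 → ℝ)) : (Fin 3 → ℝ) →L[ℝ] (Fin 5 → ℝ) :=
  M + (ContinuousLinearMap.proj (R := ℝ) (φ := fun _ : Fin 3 => ℝ) 2).smulRight (M kerVec)

/-- The second osculating space of `germ M` along `kerVec`. -/
def osculating (M : (Fin 3 → ℝ) →L[ℝ] (Fin 5 → ℝ)) : Submodule ℝ (Fin 5 → ℝ) :=
  LinearMap.range (linearPart : (Fin 3 → ℝ) →ₗ[ℝ] (Fin 5 → ℝ)) ⊔
    LinearMap.range (intrinsic M : (Fin 3 → ℝ) →ₗ[ℝ] (Fin 5 → ℝ))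

theorem linearPart_apply (p : Fin 3 → ℝ) : linearPart p = ![p 0, p 1, 0, 0, 0] := by
  ext j
  fin_cases j <;> simp [linearPart, Matrix.mulVec, dotProduct, Fin.sum_univ_three]

theorem linearPart_eq_zero_iff (p : Fin 3 → ℝ) : linearPart p = 0 ↔ p = p 2 • kerVec := by
  rw [linearPart_apply]
  constructor
  · intro h
    have h0 : p 0 = 0 := congrFun h 0
    have h1 : p 1 = 0 := congrFun h 1
    ext j
    fin_cases j <;> simp [kerVec, h0, h1]
  · intro h
    have h0 : p 0 = 0 := by rw [h]; simp [kerVec]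
    have h1 : p 1 = 0 := by rw [h]; simp [kerVec]
    ext j
    fin_cases j <;> simp [h0, h1]

theorem kerVec_two : kerVec 2 = 1 := rfl

theorem linearPart_kerVec : linearPart kerVec = 0 := by
  rw [linearPart_eq_zero_iff, kerVec_two, one_smul]

theorem contDiff_germ (M : (Fin 3 → ℝ) →L[ℝ] (Fin 5 → ℝ)) : ContDiff ℝ 2 (germ M) := by
  unfold germ
  fun_prop

theorem fderiv_germ (M : (Fin 3 → ℝ) →L[ℝ] (Fin 5 → ℝ)) :
    fderiv ℝ (germ M) = fun p => linearPart + (p 2 • M +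
      (ContinuousLinearMap.proj (R := ℝ) (φ := fun _ : Fin 3 => ℝ) 2).smulRight (M p)) := by
  funext p
  exact (linearPart.hasFDerivAt.add
    ((ContinuousLinearMap.proj (R := ℝ) (φ := fun _ : Fin 3 => ℝ) 2).hasFDerivAt.smul
      M.hasFDerivAt)).fderiv

theorem fderiv_germ_zero (M : (Fin 3 → ℝ) →L[ℝ] (Fin 5 → ℝ)) :
    fderiv ℝ (germ M) 0 = linearPart := by
  ext
  simp [fderiv_germ]

theorem fderiv_fderiv_germ_kerVec (M : (Fin 3 → ℝ) →L[ℝ] (Fin 5 → ℝ)) (v : Fin 3 → ℝ) :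
    fderiv ℝ (fderiv ℝ (germ M)) 0 v kerVec = intrinsic M v := by
  have hd : Differentiable ℝ (fderiv ℝ (germ M)) :=
    ((contDiff_germ M).fderiv_right (m := 1) (by norm_num)).differentiable (by norm_num)
  have h1 := ((ContinuousLinearMap.apply ℝ (Fin 5 → ℝ) kerVec).hasFDerivAt.comp 0
    (hd 0).hasFDerivAt).fderiv
  have h2 : (ContinuousLinearMap.apply ℝ (Fin 5 → ℝ) kerVec) ∘ fderiv ℝ (germ M) =
      fun p => intrinsic M p := by
    funext p
    rw [fderiv_germ]
    simp [linearPart_kerVec, intrinsic, kerVec_two, add_comm]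
  rw [h2, ContinuousLinearMap.fderiv] at h1
  rw [h1]
  rfl

/-- An `𝒜²`-equivalence identifies the intrinsic second derivatives. -/
theorem A2Equiv.exists_intrinsic_eq {M N : (Fin 3 → ℝ) →L[ℝ] (Fin 5 → ℝ)}
    (h : A2Equiv (germ M) (germ N)) :
    ∃ (α : (Fin 3 → ℝ) ≃L[ℝ] (Fin 3 → ℝ)) (β : (Fin 5 → ℝ) ≃L[ℝ] (Fin 5 → ℝ)) (c : ℝ),
      c ≠ 0 ∧ α kerVec = c • kerVec ∧ (∀ v, β (linearPart (α v)) = linearPart v) ∧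
      ∀ v, ∃ w, intrinsic N v = β (c • intrinsic M (α v) + linearPart w) := by
  obtain ⟨ψ, φ, α, β, hψ, hφ, hψ0, -, hα, hβ, hjet⟩ := h
  have hψ2 : ContDiff ℝ 2 ψ := contDiff_infty.1 hψ 2
  have hφ2 : ContDiff ℝ 2 φ := contDiff_infty.1 hφ 2
  have hg0 : germ M 0 = 0 := by simp [germ]
  have hlin (v : Fin 3 → ℝ) : β (linearPart (α v)) = linearPart v := by
    have h1 := congrArg (fun T => T (fun _ => v)) (hjet 1 (by norm_num))
    simp only [iteratedFDeriv_one_apply] at h1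
    have dM := (contDiff_germ M).differentiable (by norm_num)
    have hβ' : HasFDerivAt φ (β : (Fin 5 → ℝ) →L[ℝ] (Fin 5 → ℝ)) ((germ M ∘ ψ) 0) := by
      simpa [hψ0, hg0] using hβ
    rw [(hβ'.comp 0 ((dM (ψ 0)).hasFDerivAt.comp 0 hα)).fderiv, hψ0, fderiv_germ_zero,
      fderiv_germ_zero] at h1
    simpa using h1
  have hker : linearPart (α kerVec) = 0 := by
    have := hlin kerVec
    rw [linearPart_kerVec] at this
    simpa using this
  have hc := (linearPart_eq_zero_iff _).1 hker
  refine ⟨α, β, α kerVec 2, ?_, hc, hlin, fun v => ?_⟩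
  · intro h0
    rw [h0, zero_smul] at hc
    have : kerVec = 0 := by simpa using hc
    simpa [kerVec] using congrFun this 2
  · have h2 := congrArg (fun T => T ![v, kerVec]) (hjet 2 le_rfl)
    simp only [iteratedFDeriv_two_apply, Matrix.cons_val_zero, Matrix.cons_val_one] at h2
    rw [fderiv_fderiv_comp_comp_apply_of_eq_zero hφ2 (contDiff_germ M) hψ2 0 v kerVec
      (by rw [hψ0, fderiv_germ_zero, hα.fderiv]; exact hker), hψ0, hg0, hα.fderiv, hβ.fderiv,
      fderiv_germ_zero, fderiv_fderiv_germ_kerVec] at h2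
    refine ⟨fderiv ℝ (fderiv ℝ ψ) 0 v kerVec, ?_⟩
    rw [← h2, ContinuousLinearEquiv.coe_coe, ContinuousLinearEquiv.coe_coe, hc, map_smul,
      fderiv_fderiv_germ_kerVec, ← hc]

theorem A2Equiv.finrank_osculating_eq {M N : (Fin 3 → ℝ) →L[ℝ] (Fin 5 → ℝ)}
    (h : A2Equiv (germ M) (germ N)) :
    Module.finrank ℝ (osculating M) = Module.finrank ℝ (osculating N) := by
  obtain ⟨α, β, c, hc, -, hlin, hquad⟩ := h.exists_intrinsic_eq
  have hL (u) : linearPart u ∈ osculating N := Submodule.mem_sup_left ⟨u, rfl⟩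
  have hL' (u) : linearPart u ∈ osculating M := Submodule.mem_sup_left ⟨u, rfl⟩
  have hβL (u) : β (linearPart u) = linearPart (α.symm u) := by
    rw [← hlin (α.symm u), α.apply_symm_apply]
  have heq : (osculating M).map β.toLinearEquiv.toLinearMap = osculating N := by
    apply le_antisymm
    · rw [osculating, Submodule.map_sup, sup_le_iff]
      constructor
      · rintro _ ⟨_, ⟨u, rfl⟩, rfl⟩
        change β (linearPart u) ∈ _
        rw [hβL]
        exact hL _
      · rintro _ ⟨_, ⟨u, rfl⟩, rfl⟩
        change β (intrinsic M u) ∈ _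
        obtain ⟨w, hw⟩ := hquad (α.symm u)
        rw [α.apply_symm_apply, map_add, map_smul, hβL] at hw
        have : β (intrinsic M u) =
            c⁻¹ • (intrinsic N (α.symm u) - linearPart (α.symm w)) := by
          rw [hw, add_sub_cancel_right, inv_smul_smul₀ hc]
        rw [this]
        exact Submodule.smul_mem _ _ (Submodule.sub_mem _ (Submodule.mem_sup_right ⟨_, rfl⟩) (hL _))
    · rw [osculating, sup_le_iff]
      constructor
      · rintro _ ⟨u, rfl⟩
        exact ⟨linearPart (α u), hL' _, hlin u⟩
      · rintro _ ⟨u, rfl⟩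
        obtain ⟨w, hw⟩ := hquad u
        exact ⟨_, Submodule.add_mem _
          (Submodule.smul_mem _ c (Submodule.mem_sup_right ⟨α u, rfl⟩)) (hL' w), hw.symm⟩
  rw [← heq]
  exact (LinearEquiv.finrank_map_eq β.toLinearEquiv _).symm

theorem A2Equiv.intrinsic_kerVec_mem_iff {M N : (Fin 3 → ℝ) →L[ℝ] (Fin 5 → ℝ)}
    (h : A2Equiv (germ M) (germ N)) :
    intrinsic M kerVec ∈ Set.range linearPart ↔ intrinsic N kerVec ∈ Set.range linearPart := by
  obtain ⟨α, β, c, hc, hker, hlin, hquad⟩ := h.exists_intrinsic_eq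
  obtain ⟨w, hw⟩ := hquad kerVec
  rw [hker, map_smul, smul_smul] at hw
  have hcc : c * c ≠ 0 := mul_ne_zero hc hc
  constructor
  · rintro ⟨u, hu⟩
    refine ⟨α.symm ((c * c) • u + w), ?_⟩
    rw [← hlin, α.apply_symm_apply, hw, ← hu, map_add, map_smul]
  · rintro ⟨u, hu⟩
    rw [← hu, ← hlin u] at hw
    refine ⟨(c * c)⁻¹ • (α u - w), ?_⟩
    rw [map_smul, map_sub, β.injective hw, add_sub_cancel_right, inv_smul_smul₀ hcc]

/-- The matrices of the maps `normalMap i`. -/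
def normalMatrix : Fin 6 → Matrix (Fin 5) (Fin 3) ℝ :=
  ![!![0, 0, 0; 0, 0, 0; 1, 0, 0; 0, 1, 0; 0, 0, 1],
    !![0, 0, 0; 0, 0, 0; 0, 0, 1; 1, 0, 0; 0, 0, 0],
    !![0, 0, 0; 0, 0, 0; 1, 0, 0; 0, 1, 0; 0, 0, 0],
    !![0, 0, 0; 0, 0, 0; 0, 0, 1; 0, 0, 0; 0, 0, 0],
    !![0, 0, 0; 0, 0, 0; 1, 0, 0; 0, 0, 0; 0, 0, 0],
    0]

/-- The linear maps `M` for which the normal forms are `germ M`. -/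
def normalMap (i : Fin 6) : (Fin 3 → ℝ) →L[ℝ] (Fin 5 → ℝ) :=
  LinearMap.toContinuousLinearMap (Matrix.toLin' (normalMatrix i))

theorem normalForm_eq_germ (i : Fin 6) : normalForm i = germ (normalMap i) := by
  funext p
  ext j
  rw [germ, linearPart_apply]
  fin_cases i <;> fin_cases j <;>
    simp [normalForm, g1, g2, g3, g4, g5, g6, normalMap, normalMatrix,
      dotProduct, Fin.sum_univ_three] <;> ring

theorem intrinsic_normalMap (i : Fin 6) (v : Fin 3 → ℝ) :
    intrinsic (normalMap i) v =
      (![![0, 0, v 0, v 1, 2 * v 2], ![0, 0, 2 * v 2, v 0, 0], ![0, 0, v 0, v 1, 0],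
        ![0, 0, 2 * v 2, 0, 0], ![0, 0, v 0, 0, 0], 0] : Fin 6 → Fin 5 → ℝ) i := by
  ext j
  fin_cases i <;> fin_cases j <;>
    simp [intrinsic, kerVec, normalMap, normalMatrix,
      dotProduct, Fin.sum_univ_three] <;> ring

/-- The dimension of the osculating space of each normal form. -/
def osculatingDim : Fin 6 → ℕ := ![5, 4, 4, 3, 3, 2]

theorem mem_osculating_normalMap_iff (i : Fin 6) (y : Fin 5 → ℝ) :
    y ∈ osculating (normalMap i) ↔ ∀ j : Fin 5, osculatingDim i ≤ j → y j = 0 := by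
  rw [osculating, Submodule.mem_sup]
  constructor
  · rintro ⟨_, ⟨u, rfl⟩, _, ⟨v, rfl⟩, rfl⟩ j hj
    change linearPart u j + intrinsic (normalMap i) v j = 0
    rw [linearPart_apply, intrinsic_normalMap]
    fin_cases i <;> fin_cases j <;> simp_all [osculatingDim]
  · intro hy
    refine ⟨_, ⟨![y 0, y 1, 0], rfl⟩, _,
      ⟨(![![y 2, y 3, y 4 / 2], ![y 3, 0, y 2 / 2], ![y 2, y 3, 0], ![0, 0, y 2 / 2],
        ![y 2, 0, 0], 0] : Fin 6 → Fin 3 → ℝ) i, rfl⟩, ?_⟩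
    rw [ContinuousLinearMap.coe_coe, ContinuousLinearMap.coe_coe, linearPart_apply,
      intrinsic_normalMap]
    have h2 := hy 2
    have h3 := hy 3
    have h4 := hy 4
    ext j
    fin_cases i <;> fin_cases j <;> simp_all [osculatingDim] <;> ring

theorem osculating_normalMap_lt {i j : Fin 6} (h : osculatingDim i < osculatingDim j) :
    osculating (normalMap i) < osculating (normalMap j) := by
  have hi : osculatingDim i < 5 :=
    h.trans_le (by fin_cases j <;> simp [osculatingDim])
  rw [SetLike.lt_iff_le_and_exists]
  refine ⟨fun y hy => ?_, Pi.single ⟨osculatingDim i, hi⟩ 1, ?_, ?_⟩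
  · rw [mem_osculating_normalMap_iff] at hy ⊢
    exact fun k hk => hy k (h.le.trans hk)
  · rw [mem_osculating_normalMap_iff]
    intro k hk
    refine Pi.single_eq_of_ne (fun hki => ?_) _
    subst hki
    exact absurd h (not_lt.2 hk)
  · rw [mem_osculating_normalMap_iff]
    intro hz
    simpa using hz ⟨osculatingDim i, hi⟩ le_rfl

theorem intrinsic_normalMap_kerVec_mem_iff (i : Fin 6) :
    intrinsic (normalMap i) kerVec ∈ Set.range linearPart ↔ i ∈ ({2, 4, 5} : Finset (Fin 6)) := by
  have hrange (y : Fin 5 → ℝ) (hy : y ∈ Set.range linearPart) : y 2 = 0 ∧ y 4 = 0 := by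
    obtain ⟨u, rfl⟩ := hy
    simp [linearPart_apply]
  rw [intrinsic_normalMap]
  constructor
  · intro h
    have := hrange _ h
    fin_cases i <;> simp_all [kerVec]
  · intro h
    refine ⟨0, ?_⟩
    rw [map_zero]
    ext j
    fin_cases i <;> fin_cases j <;> simp_all [kerVec]

/-- No two distinct normal forms are `𝒜²`-equivalent. -/
theorem normal_forms_not_A2_equivalent :
    ∀ i j : Fin 6, i ≠ j → ¬ A2Equiv (normalForm i) (normalForm j) := by
  intro i j hij h
  rw [normalForm_eq_germ, normalForm_eq_germ] at h
  have hrank := h.finrank_osculating_eq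
  have hdim : osculatingDim i = osculatingDim j := by
    rcases lt_trichotomy (osculatingDim i) (osculatingDim j) with hlt | heq | hgt
    · exact absurd hrank (Submodule.finrank_lt_finrank_of_lt (osculating_normalMap_lt hlt)).ne
    · exact heq
    · exact absurd hrank (Submodule.finrank_lt_finrank_of_lt (osculating_normalMap_lt hgt)).ne'
  have hker := h.intrinsic_kerVec_mem_iff
  rw [intrinsic_normalMap_kerVec_mem_iff, intrinsic_normalMap_kerVec_mem_iff] at hker
  fin_cases i <;> fin_cases j <;> simp_all [osculatingDim]
end
end

section
/- Let f(x,y,z) = (x, y, Q₁(x,y,z), Q₂(x,y,z), Q₃(x,y,z)) where Q₁, Q₂, Q₃ are homogeneous quadratic polynomials, and let α be the 3×3 real matrix whose i-th row consists of the coefficients of z², xz and yz in Qᵢ. Then f is A²-equivalent to g₃(x,y,z) = (x,y,xz,yz,0) if and only if the rank of α equals 2 and the column of z²-coefficients of α (its first column) is zero. -/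
noncomputable section

section
variable {E F G : Type*} [NormedAddCommGroup E] [NormedSpace ℝ E]
  [NormedAddCommGroup F] [NormedSpace ℝ F] [NormedAddCommGroup G] [NormedSpace ℝ G]

lemma fderiv_fderiv_comp {φ : F → G} {f : E → F} (hφ : ContDiff ℝ 2 φ) (hf : ContDiff ℝ 2 f)
    (x u v : E) :
    fderiv ℝ (fderiv ℝ (φ ∘ f)) x u v =
      fderiv ℝ (fderiv ℝ φ) (f x) (fderiv ℝ f x u) (fderiv ℝ f x v) +
        fderiv ℝ φ (f x) (fderiv ℝ (fderiv ℝ f) x u v) := by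
  have dφ : Differentiable ℝ φ := hφ.differentiable (by norm_num)
  have df : Differentiable ℝ f := hf.differentiable (by norm_num)
  have ddφ : Differentiable ℝ (fderiv ℝ φ) :=
    (hφ.fderiv_right (m := 1) (by norm_num)).differentiable (by norm_num)
  have ddf : Differentiable ℝ (fderiv ℝ f) :=
    (hf.fderiv_right (m := 1) (by norm_num)).differentiable (by norm_num)
  have h : fderiv ℝ (φ ∘ f) = fun p => (fderiv ℝ φ (f p)).comp (fderiv ℝ f p) :=
    funext fun p => fderiv_comp p (dφ _) (df p)
  have h' := ((ddφ (f x)).hasFDerivAt.comp x (df x).hasFDerivAt).clm_comp (ddf x).hasFDerivAt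
  rw [h]
  erw [h'.fderiv]
  simp [add_comm]

lemma fderiv_add_bilin (L : E →L[ℝ] F) (B : E →L[ℝ] E →L[ℝ] F) :
    fderiv ℝ (fun p => L p + B p p) = fun p => L + (B + B.flip) p := by
  funext p
  refine HasFDerivAt.fderiv ((L.hasFDerivAt.add
    (B.hasFDerivAt.clm_apply (hasFDerivAt_id p))).congr_fderiv ?_)
  ext v
  simp

lemma fderiv_fderiv_add_bilin (L : E →L[ℝ] F) (B : E →L[ℝ] E →L[ℝ] F) (x : E) :
    fderiv ℝ (fderiv ℝ (fun p => L p + B p p)) x = B + B.flip := by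
  rw [fderiv_add_bilin]
  exact ((B + B.flip).hasFDerivAt.const_add L).fderiv

end

lemma Matrix.rank_eq_two_and_col_zero_iff (α : Matrix (Fin 3) (Fin 3) ℝ) :
    (α.rank = 2 ∧ ∀ i, α i 0 = 0) ↔ ∀ v : Fin 3 → ℝ, α.mulVec v = 0 ↔ v 1 = 0 ∧ v 2 = 0 := by
  have rn := α.mulVecLin.finrank_range_add_finrank_ker
  have hne : (Pi.single 0 1 : Fin 3 → ℝ) ≠ 0 := by simp
  rw [Module.finrank_fin_fun] at rn
  constructor
  · rintro ⟨hr, h0⟩ v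
    have hmem : α.mulVecLin (Pi.single 0 1) = 0 := by
      ext i; simp [h0]
    have hk : Module.finrank ℝ (LinearMap.ker α.mulVecLin) = 1 := by
      have : Module.finrank ℝ (LinearMap.range α.mulVecLin) = 2 := hr
      omega
    constructor
    · intro hv
      obtain ⟨c, hc⟩ := (finrank_eq_one_iff_of_nonzero'
        (⟨Pi.single 0 1, hmem⟩ : LinearMap.ker α.mulVecLin) (fun h => hne (congrArg Subtype.val h))).1 hk ⟨v, hv⟩
      have hc' : c • (Pi.single 0 1 : Fin 3 → ℝ) = v := congrArg Subtype.val hc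
      subst hc'
      simp
    · rintro ⟨h1, h2⟩
      ext i
      simp [Matrix.mulVec, dotProduct, Fin.sum_univ_three, h1, h2, h0]
  · intro h
    have hmem : α.mulVec (Pi.single 0 1) = 0 := (h _).2 (by simp)
    refine ⟨?_, fun i => by simpa using congrFun hmem i⟩
    have hk : Module.finrank ℝ (LinearMap.ker α.mulVecLin) = 1 := by
      refine (finrank_eq_one_iff_of_nonzero'
        (⟨Pi.single 0 1, hmem⟩ : LinearMap.ker α.mulVecLin) (fun h => hne (congrArg Subtype.val h))).2 ?_
      rintro ⟨w, hw⟩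
      obtain ⟨h1, h2⟩ := (h w).1 hw
      refine ⟨w 0, Subtype.ext ?_⟩
      ext i
      fin_cases i <;> simp [h1, h2]
    unfold Matrix.rank
    omega

/-- The quadratic form with coefficients `c` of `x², xy, y²` and `α` of `z², xz, yz`. -/
def mongeQuad (c : Fin 3 → Fin 3 → ℝ) (α : Matrix (Fin 3) (Fin 3) ℝ) (i : Fin 3)
    (p : Fin 3 → ℝ) : ℝ :=
  c i 0 * p 0 ^ 2 + c i 1 * p 0 * p 1 + c i 2 * p 1 ^ 2
        + α i 0 * p 2 ^ 2 + α i 1 * p 0 * p 2 + α i 2 * p 1 * p 2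

/-- A quadratic corank 1 map in Monge form. -/
def mongeMap (c : Fin 3 → Fin 3 → ℝ) (α : Matrix (Fin 3) (Fin 3) ℝ) (p : Fin 3 → ℝ) :
    Fin 5 → ℝ :=
  ![p 0, p 1, mongeQuad c α 0 p, mongeQuad c α 1 p, mongeQuad c α 2 p]

/-- The linear part of `mongeMap`. -/
def mongeLin : (Fin 3 → ℝ) →L[ℝ] (Fin 5 → ℝ) :=
  LinearMap.toContinuousLinearMap
    { toFun := fun p => ![p 0, p 1, 0, 0, 0]
      map_add' := fun p q => by ext i; fin_cases i <;> simp
      map_smul' := fun a p => by ext i; fin_cases i <;> simp }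

@[simp] lemma mongeLin_apply (p : Fin 3 → ℝ) : mongeLin p = ![p 0, p 1, 0, 0, 0] := rfl

/-- A bilinear form whose associated quadratic form is `mongeQuad`. -/
def mongeBilinCoord (c : Fin 3 → Fin 3 → ℝ) (α : Matrix (Fin 3) (Fin 3) ℝ) (i : Fin 3)
    (p q : Fin 3 → ℝ) : ℝ :=
  c i 0 * p 0 * q 0 + c i 1 * p 0 * q 1 + c i 2 * p 1 * q 1
        + α i 0 * p 2 * q 2 + α i 1 * p 0 * q 2 + α i 2 * p 1 * q 2

/-- The quadratic part of `mongeMap` as a (non-symmetric) bilinear map. -/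
def mongeBilin (c : Fin 3 → Fin 3 → ℝ) (α : Matrix (Fin 3) (Fin 3) ℝ) :
    (Fin 3 → ℝ) →L[ℝ] (Fin 3 → ℝ) →L[ℝ] (Fin 5 → ℝ) :=
  LinearMap.toContinuousBilinearMap <| LinearMap.mk₂ ℝ
    (fun p q => ![0, 0, mongeBilinCoord c α 0 p q, mongeBilinCoord c α 1 p q,
      mongeBilinCoord c α 2 p q])
    (fun p p' q => by ext i; fin_cases i <;> simp [mongeBilinCoord] <;> ring)
    (fun a p q => by ext i; fin_cases i <;> simp [mongeBilinCoord] <;> ring)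
    (fun p q q' => by ext i; fin_cases i <;> simp [mongeBilinCoord] <;> ring)
    (fun a p q => by ext i; fin_cases i <;> simp [mongeBilinCoord] <;> ring)

@[simp] lemma mongeBilin_apply (c : Fin 3 → Fin 3 → ℝ) (α : Matrix (Fin 3) (Fin 3) ℝ)
    (p q : Fin 3 → ℝ) :
    mongeBilin c α p q = ![0, 0, mongeBilinCoord c α 0 p q, mongeBilinCoord c α 1 p q,
      mongeBilinCoord c α 2 p q] := rfl

lemma mongeMap_eq (c : Fin 3 → Fin 3 → ℝ) (α : Matrix (Fin 3) (Fin 3) ℝ) :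
    mongeMap c α = fun p => mongeLin p + mongeBilin c α p p := by
  funext p
  ext i
  fin_cases i <;> simp [mongeMap, mongeQuad, mongeBilinCoord] <;> ring

lemma g3_eq_mongeMap : g3 = mongeMap 0 !![0, 1, 0; 0, 0, 1; 0, 0, 0] := by
  funext p
  ext i
  fin_cases i <;> simp [g3, mongeMap, mongeQuad]

lemma contDiff_mongeMap (c : Fin 3 → Fin 3 → ℝ) (α : Matrix (Fin 3) (Fin 3) ℝ)
    (n : WithTop ℕ∞) : ContDiff ℝ n (mongeMap c α) := by
  rw [mongeMap_eq]
  fun_prop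

lemma fderiv_mongeMap_zero (c : Fin 3 → Fin 3 → ℝ) (α : Matrix (Fin 3) (Fin 3) ℝ) :
    fderiv ℝ (mongeMap c α) 0 = mongeLin := by
  rw [mongeMap_eq, fderiv_add_bilin]
  simp

/-- The mixed second derivative of a map in Monge form in the direction of its kernel. -/
lemma fderiv_fderiv_mongeMap_zero (c : Fin 3 → Fin 3 → ℝ) (α : Matrix (Fin 3) (Fin 3) ℝ)
    (u v : Fin 3 → ℝ) (hu0 : u 0 = 0) (hu1 : u 1 = 0) :
    fderiv ℝ (fderiv ℝ (mongeMap c α)) 0 u v =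
      u 2 • ![0, 0, α.mulVec ![2 * v 2, v 0, v 1] 0, α.mulVec ![2 * v 2, v 0, v 1] 1,
        α.mulVec ![2 * v 2, v 0, v 1] 2] := by
  rw [mongeMap_eq, fderiv_fderiv_add_bilin]
  ext i
  fin_cases i <;>
    simp [mongeBilinCoord, Matrix.mulVec, dotProduct, Fin.sum_univ_three, hu0, hu1] <;> ring

/-- If `A ∘ L ∘ B = L` with `A` and `B` invertible, then `A` preserves and detects the range of
`L`. -/
lemma mem_range_iff_of_comp {E F : Type*} [AddCommGroup E] [Module ℝ E] [AddCommGroup F]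
    [Module ℝ F] (L : E →ₗ[ℝ] F) (A : F ≃ₗ[ℝ] F) (B : E ≃ₗ[ℝ] E)
    (h : ∀ v, A (L (B v)) = L v) (y : F) :
    A y ∈ LinearMap.range L ↔ y ∈ LinearMap.range L := by
  constructor
  · rintro ⟨v, hv⟩
    exact ⟨B v, A.injective (by rw [h, hv])⟩
  · rintro ⟨v, rfl⟩
    exact ⟨B.symm v, by rw [← h, B.apply_symm_apply]⟩

lemma mem_range_mongeLin_iff (y : Fin 5 → ℝ) :
    y ∈ LinearMap.range (mongeLin : (Fin 3 → ℝ) →ₗ[ℝ] (Fin 5 → ℝ)) ↔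
      y 2 = 0 ∧ y 3 = 0 ∧ y 4 = 0 := by
  constructor
  · rintro ⟨v, rfl⟩
    simp
  · rintro ⟨h2, h3, h4⟩
    refine ⟨![y 0, y 1, 0], ?_⟩
    ext i
    fin_cases i <;> simp [h2, h3, h4]

lemma mulVec_eq_zero_iff_of_A2Equiv {c : Fin 3 → Fin 3 → ℝ} {α : Matrix (Fin 3) (Fin 3) ℝ}
    (h : A2Equiv (mongeMap c α) g3) (v : Fin 3 → ℝ) :
    α.mulVec v = 0 ↔ v 1 = 0 ∧ v 2 = 0 := by
  obtain ⟨ψ, φ, ψ', φ', hψ, hφ, hψ0, hφ0, dψ, dφ, hjet⟩ := h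
  have hψ2 : ContDiff ℝ 2 ψ := contDiff_infty.1 hψ 2
  have hφ2 : ContDiff ℝ 2 φ := contDiff_infty.1 hφ 2
  have hf2 := contDiff_mongeMap c α 2
  have hf0 : mongeMap c α 0 = 0 := by
    rw [mongeMap_eq]
    ext i; fin_cases i <;> simp
  have hfψ2 : ContDiff ℝ 2 (mongeMap c α ∘ ψ) := hf2.comp hψ2
  have hfψ : fderiv ℝ (mongeMap c α ∘ ψ) 0 = mongeLin.comp (ψ' : _ →L[ℝ] _) := by
    rw [fderiv_comp _ (hf2.differentiable (by norm_num) _) dψ.differentiableAt, hψ0,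
      fderiv_mongeMap_zero, dψ.fderiv]
  have h1 : ∀ w, φ' (mongeLin (ψ' w)) = mongeLin w := by
    intro w
    have := congrArg (fun T => T fun _ => w) (hjet 1 (by norm_num))
    simp only [iteratedFDeriv_one_apply] at this
    rw [fderiv_comp _ (hφ2.differentiable (by norm_num) _)
      (hfψ2.differentiable (by norm_num) _), hfψ, g3_eq_mongeMap, fderiv_mongeMap_zero] at this
    rwa [Function.comp_apply, hψ0, hf0, dφ.fderiv] at this
  have hrange := mem_range_iff_of_comp mongeLin.toLinearMap φ'.toLinearEquiv ψ'.toLinearEquiv h1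
  set e : Fin 3 → ℝ := ![0, 0, 1]
  have hLe : mongeLin (ψ' e) = 0 := by
    apply φ'.injective
    rw [h1, map_zero]
    ext i; fin_cases i <;> simp [e]
  have he0 : ψ' e 0 = 0 := by simpa using congrFun hLe 0
  have he1 : ψ' e 1 = 0 := by simpa using congrFun hLe 1
  have he2 : ψ' e 2 ≠ 0 := by
    intro h2
    have : e = 0 := ψ'.injective (by
      rw [map_zero]; ext i; fin_cases i <;> simp [he0, he1, h2])
    simpa [e] using congrFun this 2
  have h2 : ∀ w, φ' (fderiv ℝ (fderiv ℝ (mongeMap c α)) 0 (ψ' e) (ψ' w) +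
      mongeLin (fderiv ℝ (fderiv ℝ ψ) 0 e w)) = fderiv ℝ (fderiv ℝ g3) 0 e w := by
    intro w
    have := congrArg (fun T => T ![e, w]) (hjet 2 le_rfl)
    simp only [iteratedFDeriv_two_apply] at this
    rw [fderiv_fderiv_comp hφ2 hfψ2, hfψ, fderiv_fderiv_comp hf2 hψ2] at this
    simpa [hψ0, hf0, dφ.fderiv, dψ.fderiv, fderiv_mongeMap_zero, hLe, -mongeLin_apply] using this
  set w := ψ'.symm ![v 1, v 2, v 0 / 2]
  have key := hrange (fderiv ℝ (fderiv ℝ (mongeMap c α)) 0 (ψ' e) (ψ' w) +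
      mongeLin (fderiv ℝ (fderiv ℝ ψ) 0 e w))
  have hv : ![2 * (v 0 / 2), v 1, v 2] = v := by
    ext i; fin_cases i <;> simp; ring
  have hw01 : w 0 = 0 ∧ w 1 = 0 ↔ v 1 = 0 ∧ v 2 = 0 := by
    have hψw : ψ' w = ![v 1, v 2, v 0 / 2] := by simp [w]
    constructor
    · rintro ⟨a, b⟩
      have : mongeLin (ψ' w) = 0 := φ'.injective (by
        rw [h1, map_zero]; ext i; fin_cases i <;> simp [a, b])
      rw [hψw] at this
      exact ⟨by simpa using congrFun this 0, by simpa using congrFun this 1⟩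
    · rintro ⟨a, b⟩
      have : mongeLin w = 0 := by
        rw [← h1, hψw, mongeLin_apply]; simp [a, b]
      exact ⟨by simpa using congrFun this 0, by simpa using congrFun this 1⟩
  erw [h2] at key
  rw [mem_range_mongeLin_iff, mem_range_mongeLin_iff, g3_eq_mongeMap,
    fderiv_fderiv_mongeMap_zero _ _ _ _ he0 he1,
    fderiv_fderiv_mongeMap_zero _ _ _ _ (by simp [e]) (by simp [e])] at key
  rw [← hw01]
  simp [e, w, he2, hv, Matrix.mulVec, dotProduct, Fin.sum_univ_three] at key
  rw [key]
  simp [funext_iff, Fin.forall_fin_succ, Matrix.mulVec, dotProduct, Fin.sum_univ_three]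

lemma exists_det_ne_zero_mul_eq {α : Matrix (Fin 3) (Fin 3) ℝ}
    (h : ∀ v : Fin 3 → ℝ, α.mulVec v = 0 ↔ v 1 = 0 ∧ v 2 = 0) :
    ∃ M : Matrix (Fin 3) (Fin 3) ℝ, IsUnit M.det ∧
      ∀ v : Fin 3 → ℝ, α.mulVec v = M.mulVec ![v 1, v 2, 0] := by
  set n := crossProduct (α.col 1) (α.col 2) with hn
  have hn0 : n ≠ 0 := by
    rw [hn, crossProduct_ne_zero_iff_linearIndependent, LinearIndependent.pair_iff]
    intro s t hst
    suffices hα : α.mulVec ![0, s, t] = 0 by simpa using (h _).1 hα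
    rw [← hst]
    ext i
    simp [Matrix.mulVec, dotProduct, Fin.sum_univ_three, mul_comm]
  refine ⟨(Matrix.of ![α.col 1, α.col 2, n]).transpose, ?_, fun v => ?_⟩
  · rw [Matrix.det_transpose, isUnit_iff_ne_zero]
    have : (Matrix.of ![α.col 1, α.col 2, n]).det = n ⬝ᵥ n := by
      change Matrix.det ![α.col 1, α.col 2, n] = _
      rw [← triple_product_eq_det, triple_product_permutation, triple_product_permutation]
    rw [this]
    simpa using hn0
  · have h0 : ∀ i, α i 0 = 0 := fun i => by
      simpa using congrFun ((h (Pi.single 0 1)).2 (by simp)) i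
    ext i
    simp [Matrix.mulVec, dotProduct, Fin.sum_univ_three, h0]

/-- Apply a matrix to the last three coordinates of `ℝ⁵`. -/
def lastThreeMap (N : Matrix (Fin 3) (Fin 3) ℝ) (y : Fin 5 → ℝ) : Fin 5 → ℝ :=
  ![y 0, y 1, N.mulVec ![y 2, y 3, y 4] 0, N.mulVec ![y 2, y 3, y 4] 1,
    N.mulVec ![y 2, y 3, y 4] 2]

lemma lastThreeMap_lastThreeMap {M N : Matrix (Fin 3) (Fin 3) ℝ} (h : M * N = 1)
    (y : Fin 5 → ℝ) : lastThreeMap M (lastThreeMap N y) = y := by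
  have key : M.mulVec ![N.mulVec ![y 2, y 3, y 4] 0, N.mulVec ![y 2, y 3, y 4] 1,
      N.mulVec ![y 2, y 3, y 4] 2] = ![y 2, y 3, y 4] := by
    have : ![N.mulVec ![y 2, y 3, y 4] 0, N.mulVec ![y 2, y 3, y 4] 1,
      N.mulVec ![y 2, y 3, y 4] 2] = N.mulVec ![y 2, y 3, y 4] := by
      ext i; fin_cases i <;> rfl
    rw [this, Matrix.mulVec_mulVec, h, Matrix.one_mulVec]
  change ![y 0, y 1, M.mulVec ![N.mulVec ![y 2, y 3, y 4] 0, N.mulVec ![y 2, y 3, y 4] 1,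
      N.mulVec ![y 2, y 3, y 4] 2] 0, M.mulVec ![N.mulVec ![y 2, y 3, y 4] 0,
      N.mulVec ![y 2, y 3, y 4] 1, N.mulVec ![y 2, y 3, y 4] 2] 1,
      M.mulVec ![N.mulVec ![y 2, y 3, y 4] 0, N.mulVec ![y 2, y 3, y 4] 1,
      N.mulVec ![y 2, y 3, y 4] 2] 2] = y
  rw [key]
  ext i; fin_cases i <;> rfl

/-- `lastThreeMap` of an invertible matrix as a linear automorphism. -/
def lastThreeEquiv (M : Matrix (Fin 3) (Fin 3) ℝ) (hM : IsUnit M.det) :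
    (Fin 5 → ℝ) ≃L[ℝ] (Fin 5 → ℝ) :=
  LinearEquiv.toContinuousLinearEquiv
    { toFun := lastThreeMap M
      invFun := lastThreeMap M⁻¹
      map_add' := fun p q => by
        ext i
        fin_cases i <;>
          simp [lastThreeMap, Matrix.mulVec, dotProduct, Fin.sum_univ_three] <;> ring
      map_smul' := fun a p => by
        ext i
        fin_cases i <;>
          simp [lastThreeMap, Matrix.mulVec, dotProduct, Fin.sum_univ_three] <;> ring
      left_inv := lastThreeMap_lastThreeMap (M.nonsing_inv_mul hM)
      right_inv := lastThreeMap_lastThreeMap (M.mul_nonsing_inv hM) }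

lemma lastThreeEquiv_apply (M : Matrix (Fin 3) (Fin 3) ℝ) (hM : IsUnit M.det)
    (y : Fin 5 → ℝ) : lastThreeEquiv M hM y = lastThreeMap M y := rfl

lemma A2Equiv_of_mulVec_eq_zero_iff {c : Fin 3 → Fin 3 → ℝ} {α : Matrix (Fin 3) (Fin 3) ℝ}
    (h : ∀ v : Fin 3 → ℝ, α.mulVec v = 0 ↔ v 1 = 0 ∧ v 2 = 0) :
    A2Equiv (mongeMap c α) g3 := by
  obtain ⟨M, hM, hαM⟩ := exists_det_ne_zero_mul_eq h
  -- The shear of the target removing the terms in `x` and `y` only.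
  set P : (Fin 5 → ℝ) →L[ℝ] (Fin 3 → ℝ) := LinearMap.toContinuousLinearMap
    { toFun := fun y => ![y 0, y 1, 0]
      map_add' := fun p q => by ext i; fin_cases i <;> simp
      map_smul' := fun a p => by ext i; fin_cases i <;> simp }
  have hPapp : ∀ y, P y = ![y 0, y 1, 0] := fun y => rfl
  set s : (Fin 5 → ℝ) → (Fin 5 → ℝ) := fun y => y - mongeBilin c 0 (P y) (P y) with hs
  have hs_smooth : ContDiff ℝ (⊤ : ℕ∞) s := by fun_prop
  have hs0 : s 0 = 0 := by simp only [hs, map_zero, sub_zero]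
  have ds : HasFDerivAt s (ContinuousLinearMap.id ℝ (Fin 5 → ℝ)) 0 := by
    refine ((hasFDerivAt_id (𝕜 := ℝ) (0 : Fin 5 → ℝ)).sub
      (((mongeBilin c 0).hasFDerivAt.comp (0 : Fin 5 → ℝ) P.hasFDerivAt).clm_apply
        P.hasFDerivAt)).congr_fderiv (ContinuousLinearMap.ext fun v => ?_)
    simp only [sub_apply, ContinuousLinearMap.comp_apply, Function.comp_apply, map_zero,
      zero_apply, add_zero, sub_zero]
  set A := (lastThreeEquiv M hM).symm
  refine ⟨id, A ∘ s, ContinuousLinearEquiv.refl ℝ _, A, contDiff_id, A.contDiff.comp hs_smooth,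
    rfl, by simp [hs0], hasFDerivAt_id 0, ?_, fun k _ => ?_⟩
  · simpa using (A : (Fin 5 → ℝ) →L[ℝ] (Fin 5 → ℝ)).hasFDerivAt.comp (0 : Fin 5 → ℝ) ds
  · congr 1
    funext p
    refine (ContinuousLinearEquiv.symm_apply_eq _).2 ?_
    have hα := hαM ![0, p 0 * p 2, p 1 * p 2]
    have h0 : ∀ i, α i 0 = 0 := fun i => by
      simpa using congrFun ((h (Pi.single 0 1)).2 (by simp)) i
    rw [lastThreeEquiv_apply]
    have e0 := congrFun hα 0
    have e1 := congrFun hα 1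
    have e2 := congrFun hα 2
    simp [Matrix.mulVec, dotProduct, Fin.sum_univ_three] at e0 e1 e2
    ext i
    fin_cases i <;> simp [hs, hPapp, mongeMap, lastThreeMap, g3, mongeQuad, mongeBilinCoord,
      Matrix.mulVec, dotProduct, Fin.sum_univ_three, h0]
    · linear_combination e0
    · linear_combination e1
    · linear_combination e2

/-- A corank 1 map in Monge form is `𝒜²`-equivalent to `(x,y,xz,yz,0)` iff the
coefficient matrix `α` of `z², xz, yz` has rank two and zero first column
(the `z²`-coefficients). -/
theorem A2_equiv_g3_iff
    (c : Fin 3 → Fin 3 → ℝ) (α : Matrix (Fin 3) (Fin 3) ℝ)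
    (Q : Fin 3 → (Fin 3 → ℝ) → ℝ)
    (hQ : ∀ i p, Q i p = c i 0 * p 0 ^ 2 + c i 1 * p 0 * p 1 + c i 2 * p 1 ^ 2
        + α i 0 * p 2 ^ 2 + α i 1 * p 0 * p 2 + α i 2 * p 1 * p 2)
    (f : (Fin 3 → ℝ) → (Fin 5 → ℝ))
    (hf : ∀ p, f p = ![p 0, p 1, Q 0 p, Q 1 p, Q 2 p]) :
    A2Equiv f g3 ↔ (α.rank = 2 ∧ ∀ i, α i 0 = 0) := by
  obtain rfl : f = mongeMap c α := by
    funext p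
    rw [hf, hQ, hQ, hQ]
    rfl
  rw [Matrix.rank_eq_two_and_col_zero_iff]
  exact ⟨mulVec_eq_zero_iff_of_A2Equiv, A2Equiv_of_mulVec_eq_zero_iff⟩
end
end

section
/- Let α be a real 3×3 matrix with entries αᵢⱼ, let Qᵢ(x,y,z) = αᵢ₁ z² + αᵢ₂ xz + αᵢ₃ yz for i = 1,2,3, and let f(x,y,z) = (x, y, Q₁(x,y,z), Q₂(x,y,z), Q₃(x,y,z)). Then f is A²-equivalent to g₁(x,y,z) = (x,y,xz,yz,z²) if and only if the curvature locus Δ_f is not contained in any 2-dimensional affine subspace of ℝ³. -/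
noncomputable section

/-- The curvature locus at the origin of a corank 1 3-manifold in Monge form with
quadratic part `Q = (Q₁,Q₂,Q₃)`: the image of the unit cylinder `a² + b² = 1`
under twice the quadratic part, inside the normal space `ℝ³`. -/
def curvLocus (Q : Fin 3 → (Fin 3 → ℝ) → ℝ) : Set (Fin 3 → ℝ) :=
  {v | ∃ a b c : ℝ, a ^ 2 + b ^ 2 = 1 ∧
    v = ![2 * Q 0 ![a, b, c], 2 * Q 1 ![a, b, c], 2 * Q 2 ![a, b, c]]}

/-- If `μ ∘ Dφ(y(a)) ∘ y = 0` and `Dy(a) u = 0`, then `μ` annihilates `D²(φ ∘ y)(a)(u, ·)`. -/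
lemma apply_fderiv_fderiv_comp_eq_zero {E F G : Type*} [NormedAddCommGroup E] [NormedSpace ℝ E]
    [NormedAddCommGroup F] [NormedSpace ℝ F] [NormedAddCommGroup G] [NormedSpace ℝ G]
    {φ : F → G} {y : E → F} (hφ : ContDiff ℝ 2 φ) (hy : ContDiff ℝ 2 y) (μ : G →L[ℝ] ℝ) (a u w : E)
    (hL : ∀ x, μ (fderiv ℝ φ (y a) (y x)) = 0) (hu : fderiv ℝ y a u = 0) :
    μ (fderiv ℝ (fderiv ℝ (φ ∘ y)) a u w) = 0 := by
  have hφd : Differentiable ℝ φ := hφ.differentiable (by norm_num)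
  have hyd : Differentiable ℝ y := hy.differentiable (by norm_num)
  have hφd2 : Differentiable ℝ (fderiv ℝ φ) :=
    (hφ.fderiv_right (m := 1) (by norm_num)).differentiable (by norm_num)
  have hyd2 : Differentiable ℝ (fderiv ℝ y) :=
    (hy.fderiv_right (m := 1) (by norm_num)).differentiable (by norm_num)
  have hcomp : fderiv ℝ (φ ∘ y) = fun x => (fderiv ℝ φ (y x)).comp (fderiv ℝ y x) := by
    funext x
    exact fderiv_comp x (hφd _) (hyd _)
  have hDy : ∀ x v, μ (fderiv ℝ φ (y a) (fderiv ℝ y x v)) = 0 := by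
    intro x v
    have h1 : HasFDerivAt (fun x => (μ.comp (fderiv ℝ φ (y a))) (y x))
        ((μ.comp (fderiv ℝ φ (y a))).comp (fderiv ℝ y x)) x :=
      (μ.comp (fderiv ℝ φ (y a))).hasFDerivAt.comp x (hyd x).hasFDerivAt
    have h2 : (fun x => (μ.comp (fderiv ℝ φ (y a))) (y x)) = fun _ => (0 : ℝ) := funext hL
    rw [h2] at h1
    have h3 := h1.unique (hasFDerivAt_const (0 : ℝ) x)
    simpa using DFunLike.congr_fun h3 v
  have hD2y : μ (fderiv ℝ φ (y a) (fderiv ℝ (fderiv ℝ y) a u w)) = 0 := by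
    have h1 : HasFDerivAt (fun x => (μ.comp (fderiv ℝ φ (y a))) (fderiv ℝ y x w))
        ((μ.comp (fderiv ℝ φ (y a))).comp ((fderiv ℝ (fderiv ℝ y) a).flip w)) a := by
      refine (μ.comp (fderiv ℝ φ (y a))).hasFDerivAt.comp a ?_
      simpa using (hyd2 a).hasFDerivAt.clm_apply (hasFDerivAt_const w a)
    have h2 : (fun x => (μ.comp (fderiv ℝ φ (y a))) (fderiv ℝ y x w)) = fun _ => (0 : ℝ) :=
      funext fun x => hDy x w
    rw [h2] at h1
    have h3 := h1.unique (hasFDerivAt_const (0 : ℝ) a)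
    simpa using DFunLike.congr_fun h3 u
  have h := (((hφd2 (y a)).hasFDerivAt.comp a (hyd a).hasFDerivAt).clm_comp
    (hyd2 a).hasFDerivAt).fderiv
  rw [hcomp]
  simp only [Function.comp_def] at h
  rw [h]
  simp [hu, hD2y]

lemma contDiff_g1 {n : WithTop ℕ∞} : ContDiff ℝ n g1 := by
  rw [contDiff_pi]
  intro i
  fin_cases i <;> simp [g1] <;> fun_prop

lemma fderiv_g1_apply (p w : Fin 3 → ℝ) :
    fderiv ℝ g1 p w =
      ![w 0, w 1, w 0 * p 2 + p 0 * w 2, w 1 * p 2 + p 1 * w 2, 2 * p 2 * w 2] := by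
  have hd : DifferentiableAt ℝ g1 p :=
    (contDiff_g1 (n := 1)).differentiable (by norm_num) p
  have hX : ∀ j : Fin 3, HasFDerivAt (fun q : Fin 3 → ℝ => q j)
      (ContinuousLinearMap.proj (R := ℝ) (φ := fun _ : Fin 3 => ℝ) j) p :=
    fun j => hasFDerivAt_apply j p
  ext i
  have hi : fderiv ℝ g1 p w i = fderiv ℝ (fun q => g1 q i) p w := by
    rw [fderiv_pi (fun i => differentiableAt_pi.1 hd i)]
    rfl
  rw [hi]
  fin_cases i
  · simpa [g1] using DFunLike.congr_fun (hX 0).fderiv w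
  · simpa [g1] using DFunLike.congr_fun (hX 1).fderiv w
  · refine (DFunLike.congr_fun ((hX 0).mul (hX 2)).fderiv w).trans ?_
    simp
    ring
  · refine (DFunLike.congr_fun ((hX 1).mul (hX 2)).fderiv w).trans ?_
    simp
    ring
  · simpa [g1] using DFunLike.congr_fun ((hX 2).pow 2).fderiv w

lemma fderiv_fderiv_g1_apply (w : Fin 3 → ℝ) :
    fderiv ℝ (fderiv ℝ g1) 0 (Pi.single 2 1) w = ![0, 0, w 0, w 1, 2 * w 2] := by
  have hd : DifferentiableAt ℝ (fderiv ℝ g1) 0 :=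
    ((contDiff_g1 (n := 2)).fderiv_right (m := 1) (by norm_num)).differentiable (by norm_num) 0
  have h1 : HasFDerivAt (fun p => fderiv ℝ g1 p w) ((fderiv ℝ (fderiv ℝ g1) 0).flip w) 0 := by
    simpa using hd.hasFDerivAt.clm_apply (hasFDerivAt_const w (0 : Fin 3 → ℝ))
  have h2 : HasDerivAt (fun t : ℝ => fderiv ℝ g1 (t • Pi.single 2 1) w)
      ((fderiv ℝ (fderiv ℝ g1) 0).flip w (Pi.single 2 1)) 0 := by
    have hl : HasDerivAt (fun t : ℝ => t • (Pi.single 2 1 : Fin 3 → ℝ)) (Pi.single 2 1) 0 := by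
      simpa using (hasDerivAt_id (0 : ℝ)).smul_const (Pi.single 2 1 : Fin 3 → ℝ)
    exact h1.comp_hasDerivAt_of_eq (0 : ℝ) hl (zero_smul ℝ _).symm
  have h3 : HasDerivAt (fun t : ℝ => fderiv ℝ g1 (t • Pi.single 2 1) w)
      ![0, 0, w 0, w 1, 2 * w 2] 0 := by
    simp only [fderiv_g1_apply]
    rw [hasDerivAt_pi]
    intro i
    fin_cases i
    · simpa using hasDerivAt_const (0 : ℝ) (w 0)
    · simpa using hasDerivAt_const (0 : ℝ) (w 1)
    · simpa using (hasDerivAt_id (0 : ℝ)).const_mul (w 0)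
    · simpa using (hasDerivAt_id (0 : ℝ)).const_mul (w 1)
    · simpa using ((hasDerivAt_id (0 : ℝ)).const_mul 2).mul_const (w 2)
  exact h2.unique h3

/-- The map with quadratic part `α (z², xz, yz)` is `𝒜²`-equivalent to `g1` if and only if
`α` is invertible. -/
lemma A2Equiv_g1_iff_det_ne_zero (α : Matrix (Fin 3) (Fin 3) ℝ) (f : (Fin 3 → ℝ) → (Fin 5 → ℝ))
    (hf : ∀ p, f p = ![p 0, p 1,
      α 0 0 * p 2 ^ 2 + α 0 1 * p 0 * p 2 + α 0 2 * p 1 * p 2,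
      α 1 0 * p 2 ^ 2 + α 1 1 * p 0 * p 2 + α 1 2 * p 1 * p 2,
      α 2 0 * p 2 ^ 2 + α 2 1 * p 0 * p 2 + α 2 2 * p 1 * p 2]) :
    A2Equiv f g1 ↔ α.det ≠ 0 := by
  constructor
  · rintro ⟨ψ, φ, -, φ', hψ, hφ, hψ0, -, -, hφ', hjet⟩ hdet
    obtain ⟨l, hl0, hl⟩ := Matrix.exists_vecMul_eq_zero_iff.2 hdet
    have hf2 : ContDiff ℝ 2 f := by
      rw [funext hf, contDiff_pi]
      intro i
      fin_cases i <;> simp <;> fun_prop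
    have hψ2 : ContDiff ℝ 2 ψ := hψ.of_le (WithTop.coe_le_coe.2 (le_top : (2 : ℕ∞) ≤ ⊤))
    have hφ2 : ContDiff ℝ 2 φ := hφ.of_le (WithTop.coe_le_coe.2 (le_top : (2 : ℕ∞) ≤ ⊤))
    have hy : ContDiff ℝ 2 (f ∘ ψ) := hf2.comp hψ2
    have hy0 : (f ∘ ψ) 0 = 0 := by
      ext i
      fin_cases i <;> simp [hψ0, hf]
    let proj (i : Fin 5) : (Fin 5 → ℝ) →L[ℝ] ℝ := ContinuousLinearMap.proj i
    let L : (Fin 5 → ℝ) →L[ℝ] ℝ := l 0 • proj 2 + l 1 • proj 3 + l 2 • proj 4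
    have hLapp : ∀ v, L v = l 0 * v 2 + l 1 * v 3 + l 2 * v 4 := fun v => rfl
    have hLf : ∀ p, L (f p) = 0 := by
      intro p
      have h0 := congrFun hl 0
      have h1 := congrFun hl 1
      have h2 := congrFun hl 2
      simp only [Matrix.vecMul, dotProduct, Fin.sum_univ_three, Pi.zero_apply] at h0 h1 h2
      rw [hLapp, hf]
      simp
      linear_combination p 2 ^ 2 * h0 + p 0 * p 2 * h1 + p 1 * p 2 * h2
    set μ : (Fin 5 → ℝ) →L[ℝ] ℝ := L.comp (φ'.symm : (Fin 5 → ℝ) →L[ℝ] (Fin 5 → ℝ)) with hμ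
    have hφd : fderiv ℝ φ ((f ∘ ψ) 0) = φ' := by rw [hy0]; exact hφ'.fderiv
    have hLy : ∀ x, μ (fderiv ℝ φ ((f ∘ ψ) 0) ((f ∘ ψ) x)) = 0 := by
      intro x
      rw [hφd]
      simp [hμ, hLf]
    have hyd : Differentiable ℝ (f ∘ ψ) := hy.differentiable (by norm_num)
    have hjet1 : ∀ w, φ' (fderiv ℝ (f ∘ ψ) 0 w) = fderiv ℝ g1 0 w := by
      intro w
      have h := DFunLike.congr_fun (hjet 1 (by norm_num)) (fun _ => w)
      rw [iteratedFDeriv_one_apply, iteratedFDeriv_one_apply,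
        fderiv_comp _ (hφ2.differentiable (by norm_num) _) (hyd 0), hφd] at h
      exact h
    have hu : fderiv ℝ (f ∘ ψ) 0 (Pi.single 2 1) = 0 := by
      apply φ'.injective
      rw [hjet1, fderiv_g1_apply, map_zero]
      ext i
      fin_cases i <;> simp
    have hμ2 : ∀ w : Fin 3 → ℝ, μ ![0, 0, w 0, w 1, 2 * w 2] = 0 := by
      intro w
      have h := DFunLike.congr_fun (hjet 2 le_rfl) ![Pi.single 2 1, w]
      rw [iteratedFDeriv_two_apply, iteratedFDeriv_two_apply] at h
      simp only [Matrix.cons_val_zero, Matrix.cons_val_one] at h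
      rw [fderiv_fderiv_g1_apply] at h
      rw [← h]
      exact apply_fderiv_fderiv_comp_eq_zero hφ2 hy μ 0 _ w hLy hu
    have hμ1 : ∀ w : Fin 3 → ℝ, μ ![w 0, w 1, 0, 0, 0] = 0 := by
      intro w
      have h1 : HasFDerivAt (fun x => L ((f ∘ ψ) x)) (L.comp (fderiv ℝ (f ∘ ψ) 0)) 0 :=
        L.hasFDerivAt.comp 0 (hyd 0).hasFDerivAt
      have h2 : (fun x => L ((f ∘ ψ) x)) = fun _ => (0 : ℝ) := funext fun x => hLf (ψ x)
      rw [h2] at h1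
      have h3 := DFunLike.congr_fun (h1.unique (hasFDerivAt_const (0 : ℝ) 0)) w
      have h4 := hjet1 w
      rw [fderiv_g1_apply] at h4
      simp only [Pi.zero_apply, mul_zero, zero_mul, add_zero] at h4
      rw [← h4]
      simpa [hμ] using h3
    have hμ0 : ∀ v, μ v = 0 := by
      intro v
      have h := congrArg₂ (· + ·) (hμ1 ![v 0, v 1, 0]) (hμ2 ![v 2, v 3, v 4 / 2])
      simp only [← map_add] at h
      rw [add_zero] at h
      convert h using 2
      ext i
      fin_cases i <;> simp
      ring
    have hL0 : ∀ v, L v = 0 := by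
      intro v
      simpa [hμ] using hμ0 (φ' v)
    apply hl0
    ext i
    fin_cases i
    · simpa [hLapp] using hL0 (Pi.single 2 1)
    · simpa [hLapp] using hL0 (Pi.single 3 1)
    · simpa [hLapp] using hL0 (Pi.single 4 1)
  · intro hdet
    let swap : (Fin 5 → ℝ) →ₗ[ℝ] (Fin 5 → ℝ) :=
      { toFun := fun v => ![v 0, v 1,
          (α⁻¹.mulVec ![v 2, v 3, v 4]) 1, (α⁻¹.mulVec ![v 2, v 3, v 4]) 2,
          (α⁻¹.mulVec ![v 2, v 3, v 4]) 0]
        map_add' := fun v w => by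
          ext i
          fin_cases i <;> simp [Matrix.mulVec, dotProduct, Fin.sum_univ_three] <;> ring
        map_smul' := fun c v => by
          ext i
          fin_cases i <;> simp [Matrix.mulVec, dotProduct, Fin.sum_univ_three] <;> ring }
    have hinj : Function.Injective swap := by
      rw [← LinearMap.ker_eq_bot, LinearMap.ker_eq_bot']
      intro v hv
      have hcoord : ∀ i, swap v i = 0 := fun i => congrFun hv i
      have hinv : α⁻¹.mulVec ![v 2, v 3, v 4] = 0 := by
        ext i
        fin_cases i
        · exact hcoord 4
        · exact hcoord 2
        · exact hcoord 3
      have hlast : ![v 2, v 3, v 4] = 0 := by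
        have h := congrArg α.mulVec hinv
        rwa [Matrix.mulVec_mulVec, Matrix.mul_nonsing_inv _ (isUnit_iff_ne_zero.2 hdet),
          Matrix.one_mulVec, Matrix.mulVec_zero] at h
      ext i
      fin_cases i
      · exact hcoord 0
      · exact hcoord 1
      · exact congrFun hlast 0
      · exact congrFun hlast 1
      · exact congrFun hlast 2
    let φ' : (Fin 5 → ℝ) ≃L[ℝ] (Fin 5 → ℝ) :=
      (LinearEquiv.ofInjectiveEndo swap hinj).toContinuousLinearEquiv
    have hcomp : φ' ∘ f ∘ id = g1 := by
      funext p
      have hquad : ![f p 2, f p 3, f p 4] = α.mulVec ![p 2 ^ 2, p 0 * p 2, p 1 * p 2] := by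
        ext i
        fin_cases i <;> (simp [hf, Matrix.mulVec, dotProduct, Fin.sum_univ_three]; ring)
      change swap (f p) = g1 p
      have hinv : α⁻¹.mulVec ![f p 2, f p 3, f p 4] = ![p 2 ^ 2, p 0 * p 2, p 1 * p 2] := by
        rw [hquad, Matrix.mulVec_mulVec, Matrix.nonsing_inv_mul _ (isUnit_iff_ne_zero.2 hdet),
          Matrix.one_mulVec]
      simp only [swap, LinearMap.coe_mk, AddHom.coe_mk, hinv]
      simp [hf, g1]
    exact ⟨id, φ', ContinuousLinearEquiv.refl ℝ _, φ', contDiff_id, φ'.contDiff, rfl,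
      map_zero φ', hasFDerivAt_id 0, φ'.hasFDerivAt, fun k _ => by rw [hcomp]⟩

lemma locus_contained_iff_det_eq_zero (α : Matrix (Fin 3) (Fin 3) ℝ)
    (Q : Fin 3 → (Fin 3 → ℝ) → ℝ)
    (hQ : ∀ i p, Q i p = α i 0 * p 2 ^ 2 + α i 1 * p 0 * p 2 + α i 2 * p 1 * p 2) :
    (∃ (v₀ : Fin 3 → ℝ) (W : Submodule ℝ (Fin 3 → ℝ)),
      Module.finrank ℝ W = 2 ∧ ∀ v ∈ curvLocus Q, v - v₀ ∈ W) ↔ α.det = 0 := by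
  have hmem : ∀ a b c : ℝ, a ^ 2 + b ^ 2 = 1 →
      α.mulVec ![2 * c ^ 2, 2 * a * c, 2 * b * c] ∈ curvLocus Q := by
    intro a b c h
    refine ⟨a, b, c, h, ?_⟩
    ext i
    fin_cases i <;> simp [hQ, Matrix.mulVec, dotProduct, Fin.sum_univ_three] <;> ring
  constructor
  · rintro ⟨v₀, W, hW, hsub⟩
    by_contra hdet
    have hdiff : ∀ a b c : ℝ, a ^ 2 + b ^ 2 = 1 →
        α.mulVec ![2 * c ^ 2, 2 * a * c, 2 * b * c] ∈ W := by
      intro a b c h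
      have h1 := W.sub_mem (hsub _ (hmem a b c h)) (hsub _ (hmem 1 0 0 (by norm_num)))
      have h0 : (![2 * (0 : ℝ) ^ 2, 2 * 1 * 0, 2 * 0 * 0] : Fin 3 → ℝ) = 0 := by
        ext i
        fin_cases i <;> simp
      rw [h0, Matrix.mulVec_zero] at h1
      simpa using h1
    have htop : W = ⊤ := by
      rw [eq_top_iff]
      intro v _
      obtain ⟨u, rfl⟩ : ∃ u, α.mulVec u = v :=
        ⟨α⁻¹.mulVec v, by
          rw [Matrix.mulVec_mulVec, Matrix.mul_nonsing_inv _ (isUnit_iff_ne_zero.2 hdet),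
            Matrix.one_mulVec]⟩
      have h1 := hdiff 1 0 1 (by norm_num)
      have h2 := hdiff 1 0 (-1) (by norm_num)
      have h3 := hdiff 0 1 1 (by norm_num)
      have h := W.add_mem (W.add_mem (W.smul_mem ((u 0 + u 1 - u 2) / 4) h1)
        (W.smul_mem ((u 0 - u 1 - u 2) / 4) h2)) (W.smul_mem (u 2 / 2) h3)
      simp only [← Matrix.mulVec_smul, ← Matrix.mulVec_add] at h
      convert h using 2
      ext i
      fin_cases i <;> simp <;> ring
    rw [htop, finrank_top] at hW
    simp at hW
  · intro hdet
    obtain ⟨l, hl0, hl⟩ := Matrix.exists_vecMul_eq_zero_iff.2 hdet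
    let ℓ : Module.Dual ℝ (Fin 3 → ℝ) := dotProductBilin ℝ ℝ l
    refine ⟨0, LinearMap.ker ℓ, ?_, ?_⟩
    · have hne : ℓ ≠ 0 := by
        intro h
        exact hl0 (dotProduct_eq_zero l fun w => DFunLike.congr_fun h w)
      have := Module.Dual.finrank_ker_add_one_of_ne_zero hne
      simp at this
      omega
    · rintro v ⟨a, b, c, -, rfl⟩
      have h0 := congrFun hl 0
      have h1 := congrFun hl 1
      have h2 := congrFun hl 2
      simp only [Matrix.vecMul, dotProduct, Fin.sum_univ_three, Pi.zero_apply] at h0 h1 h2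
      rw [sub_zero, LinearMap.mem_ker]
      simp [ℓ, dotProduct, Fin.sum_univ_three, hQ]
      linear_combination 2 * c ^ 2 * h0 + 2 * a * c * h1 + 2 * b * c * h2

/-- For the special Monge form, `𝒜²`-equivalence to the cross-cap `(x,y,xz,yz,z²)`
is characterised by the curvature locus not lying in any 2-dimensional affine
subspace of the normal space `ℝ³`. -/
theorem A2_equiv_g1_iff_locus_substantial
    (α : Matrix (Fin 3) (Fin 3) ℝ) (Q : Fin 3 → (Fin 3 → ℝ) → ℝ)
    (hQ : ∀ i p, Q i p = α i 0 * p 2 ^ 2 + α i 1 * p 0 * p 2 + α i 2 * p 1 * p 2)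
    (f : (Fin 3 → ℝ) → (Fin 5 → ℝ))
    (hf : ∀ p, f p = ![p 0, p 1, Q 0 p, Q 1 p, Q 2 p]) :
    A2Equiv f g1 ↔
      ¬ ∃ (v₀ : Fin 3 → ℝ) (W : Submodule ℝ (Fin 3 → ℝ)),
        Module.finrank ℝ W = 2 ∧ ∀ v ∈ curvLocus Q, v - v₀ ∈ W := by
  rw [A2Equiv_g1_iff_det_ne_zero α f (by simpa only [hQ] using hf),
    locus_contained_iff_det_eq_zero α Q hQ]
end
end
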